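/- arXiv:1702.05894 — 11 statements merged into one kernel-verified Lean document; each statement's English description precedes it below -/
import Mathlib

section
/- For every real number α and every z > 0, one has K_α(z)·z^α = 2^{−α−1} ∫₀^∞ exp(−z²t − 1/(4t)) t^{−α−1} dt. -/
open MeasureTheory Real Set

/-- The modified Bessel function of the second kind, via Schläfli's integral. -/
noncomputable def matK (a z : ℝ) : ℝ :=
  (1 / 2) * ∫ t : ℝ, Real.exp (-z * Real.cosh t - a * t)

/-- Exponential change of variables on the half-line: `t = c * exp u`. -/
theorem integral_Ioi_eq_integral_mul_exp {c : ℝ} (hc : 0 < c) (g : ℝ → ℝ) :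
    ∫ t in Ioi (0 : ℝ), g t = ∫ u : ℝ, c * Real.exp u * g (c * Real.exp u) := by
  have himage : (fun u : ℝ => c * Real.exp u) '' univ = Ioi 0 := by
    ext t
    simp only [image_univ, mem_range, mem_Ioi]
    constructor
    · rintro ⟨u, rfl⟩
      positivity
    · intro ht
      refine ⟨Real.log (t / c), ?_⟩
      rw [Real.exp_log (by positivity)]
      field_simp
  have hmono : MonotoneOn (fun u : ℝ => c * Real.exp u) univ := fun u _ v _ huv =>
    mul_le_mul_of_nonneg_left (Real.exp_le_exp.mpr huv) hc.le
  have h := integral_image_eq_integral_deriv_smul_of_monotoneOn MeasurableSet.univ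
    (fun u _ => ((Real.hasDerivAt_exp u).const_mul c).hasDerivWithinAt) hmono g
  rwa [himage, setIntegral_univ] at h

theorem matK_eq_integral (α z : ℝ) (hz : 0 < z) :
    matK α z * z ^ α =
      (2 : ℝ) ^ (-α - 1) *
        ∫ t in Ioi (0 : ℝ), Real.exp (-z ^ 2 * t - 1 / (4 * t)) * t ^ (-α - 1) := by
  have hc : 0 < 1 / (2 * z) := by positivity
  have hpoint (u : ℝ) :
      1 / (2 * z) * Real.exp u * (Real.exp (-z ^ 2 * (1 / (2 * z) * Real.exp u) -
          1 / (4 * (1 / (2 * z) * Real.exp u))) * (1 / (2 * z) * Real.exp u) ^ (-α - 1)) =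
        (2 * z) ^ α * Real.exp (-z * Real.cosh u - α * u) := by
    have hexponent : -z ^ 2 * (1 / (2 * z) * Real.exp u) -
        1 / (4 * (1 / (2 * z) * Real.exp u)) = -z * Real.cosh u := by
      rw [Real.cosh_eq, Real.exp_neg]
      field_simp
      ring
    have hpow : 1 / (2 * z) * Real.exp u * (1 / (2 * z) * Real.exp u) ^ (-α - 1) =
        (2 * z) ^ α * Real.exp (-(α * u)) := by
      rw [Real.rpow_sub_one (by positivity), mul_div_cancel₀ _ (by positivity),
        Real.mul_rpow hc.le (Real.exp_pos u).le, ← Real.exp_mul, one_div,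
        Real.inv_rpow (by positivity), Real.rpow_neg (by positivity), inv_inv]
      ring_nf
    rw [hexponent, sub_eq_add_neg (-z * Real.cosh u), Real.exp_add, mul_left_comm, hpow]
    ring
  rw [integral_Ioi_eq_integral_mul_exp hc, integral_congr_ae (ae_of_all _ hpoint),
    integral_const_mul, matK, Real.mul_rpow two_pos.le hz.le,
    Real.rpow_sub_one two_ne_zero, Real.rpow_neg two_pos.le]
  have : (2 : ℝ) ^ α ≠ 0 := by positivity
  field_simp
end

section
/- For every α > 0, the function f_α(t) = (1/(4^α Γ(α))) exp(−1/(4t)) t^{−α−1} (for t > 0) satisfies ∫₀^∞ f_α(t) dt = 1, and for every z > 0 one has (2^{1−α}/Γ(α)) K_α(z) z^α = ∫₀^∞ e^{−z² t} f_α(t) dt. -/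
open MeasureTheory Real Set

theorem integral_Ioi_eq_integral_const_mul_exp {c : ℝ} (hc : 0 < c) (g : ℝ → ℝ) :
    ∫ t in Ioi (0 : ℝ), g t = ∫ u : ℝ, (c * Real.exp u) * g (c * Real.exp u) := by
  have himage : (fun u : ℝ => c * Real.exp u) '' univ = Ioi 0 := by
    ext t
    simp only [image_univ, mem_range, mem_Ioi]
    constructor
    · rintro ⟨u, rfl⟩
      positivity
    · intro ht
      exact ⟨Real.log (t / c), by rw [Real.exp_log (div_pos ht hc)]; field_simp⟩
  have hinj : InjOn (fun u : ℝ => c * Real.exp u) univ := fun u _ v _ huv =>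
    Real.exp_injective (mul_left_cancel₀ hc.ne' huv)
  have h := integral_image_eq_integral_abs_deriv_smul MeasurableSet.univ
    (fun u _ => ((Real.hasDerivAt_exp u).const_mul c).hasDerivWithinAt) hinj g
  rw [himage, setIntegral_univ] at h
  rw [h]
  refine integral_congr_ae (ae_of_all _ fun u => ?_)
  simp only [smul_eq_mul]
  rw [abs_of_pos (by positivity)]

theorem integral_exp_neg_one_div_mul_rpow {α : ℝ} (hα : 0 < α) :
    ∫ t in Ioi (0 : ℝ), Real.exp (-1 / (4 * t)) * t ^ (-α - 1) = 4 ^ α * Real.Gamma α := by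
  rw [← integral_comp_rpow_Ioi _ (p := -1) (by norm_num)]
  have h := integral_rpow_mul_exp_neg_mul_Ioi hα (r := 1 / 4) (by norm_num)
  rw [one_div_one_div] at h
  rw [← h]
  refine setIntegral_congr_fun measurableSet_Ioi fun t ht => ?_
  have ht' : 0 < t := ht
  simp only [smul_eq_mul, abs_neg, abs_one, one_mul]
  rw [← rpow_mul ht'.le, mul_left_comm, ← rpow_add ht', rpow_neg_one, mul_comm]
  congr 2
  · ring
  · field_simp

theorem integral_exp_neg_sq_mul_exp_neg_one_div_mul_rpow (α : ℝ) {z : ℝ} (hz : 0 < z) :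
    ∫ t in Ioi (0 : ℝ), Real.exp (-z ^ 2 * t) * (Real.exp (-1 / (4 * t)) * t ^ (-α - 1)) =
      (2 * z) ^ α * (2 * matK α z) := by
  rw [integral_Ioi_eq_integral_const_mul_exp (c := (2 * z)⁻¹) (by positivity), matK,
    ← mul_assoc 2, mul_one_div_cancel two_ne_zero, one_mul, ← integral_const_mul]
  refine integral_congr_ae (ae_of_all _ fun u => ?_)
  have ht : 0 < (2 * z)⁻¹ * Real.exp u := by positivity
  have hpow : ((2 * z)⁻¹ * Real.exp u) * ((2 * z)⁻¹ * Real.exp u) ^ (-α - 1) =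
      (2 * z) ^ α * Real.exp (-α * u) := by
    rw [rpow_sub_one ht.ne', mul_div_cancel₀ _ ht.ne', mul_rpow (by positivity) (by positivity),
      inv_rpow (by positivity), rpow_neg (by positivity), inv_inv, ← Real.exp_mul, mul_comm u]
  have hexp : -z ^ 2 * ((2 * z)⁻¹ * Real.exp u) + -1 / (4 * ((2 * z)⁻¹ * Real.exp u)) =
      -z * Real.cosh u := by
    rw [Real.cosh_eq, Real.exp_neg]
    field_simp
    ring
  simp only
  rw [sub_eq_add_neg _ (α * u), ← neg_mul α, Real.exp_add, ← hexp, Real.exp_add]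
  linear_combination
    Real.exp (-z ^ 2 * ((2 * z)⁻¹ * Real.exp u)) *
      Real.exp (-1 / (4 * ((2 * z)⁻¹ * Real.exp u))) * hpow

theorem matern_schoenberg_representation (α : ℝ) (hα : 0 < α) (f : ℝ → ℝ)
    (hf : ∀ t : ℝ, 0 < t →
      f t = (1 / ((4 : ℝ) ^ α * Real.Gamma α)) * Real.exp (-1 / (4 * t)) * t ^ (-α - 1)) :
    (∫ t in Ioi (0 : ℝ), f t) = 1 ∧
      ∀ z : ℝ, 0 < z →
        ((2 : ℝ) ^ (1 - α) / Real.Gamma α) * matK α z * z ^ α =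
          ∫ t in Ioi (0 : ℝ), Real.exp (-z ^ 2 * t) * f t := by
  have hΓ : 0 < Real.Gamma α := Real.Gamma_pos_of_pos hα
  constructor
  · rw [setIntegral_congr_fun measurableSet_Ioi fun t ht => (hf t ht).trans (mul_assoc _ _ _),
      integral_const_mul, integral_exp_neg_one_div_mul_rpow hα]
    exact one_div_mul_cancel (by positivity)
  · intro z hz
    have hcongr : ∀ t ∈ Ioi (0 : ℝ), Real.exp (-z ^ 2 * t) * f t =
        (1 / ((4 : ℝ) ^ α * Real.Gamma α)) *
          (Real.exp (-z ^ 2 * t) * (Real.exp (-1 / (4 * t)) * t ^ (-α - 1))) := by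
      intro t ht
      rw [hf t ht]
      ring
    rw [setIntegral_congr_fun measurableSet_Ioi hcongr, integral_const_mul,
      integral_exp_neg_sq_mul_exp_neg_one_div_mul_rpow α hz, mul_rpow two_pos.le hz.le,
      rpow_sub two_pos, rpow_one, show (4 : ℝ) = 2 * 2 by norm_num,
      mul_rpow two_pos.le two_pos.le]
    field_simp
end

section
/- For every α > 0, the normalized Matérn function 𝓜_α is positive definite on every Euclidean space: for every positive integer n, every finite family of distinct points x_1, …, x_N ∈ ℝⁿ and every family of complex numbers a_1, …, a_N not all zero, the sum Σ_{j=1}^N Σ_{k=1}^N 𝓜_α(|x_j − x_k|) a_j · conj(a_k) is a real number and is strictly positive. -/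
open MeasureTheory Real Set

/-- The normalized Matérn function `𝓜_α`, with `𝓜_α(0) = 1`. -/
noncomputable def matern (a z : ℝ) : ℝ :=
  if z = 0 then 1 else ((2 : ℝ) ^ (1 - a) / Real.Gamma a) * matK a z * z ^ a

/-- A quadratic form whose kernel is an integral is the integral of the quadratic forms. -/
lemma sum_integral_kernel {Ω ι : Type*} [MeasurableSpace Ω] [Fintype ι] {μ : Measure Ω}
    {φ : ι → ι → Ω → ℝ} (hφ : ∀ j k, Integrable (φ j k) μ) (a : ι → ℂ) :
    ∑ j, ∑ k, ((∫ ω, φ j k ω ∂μ : ℝ) : ℂ) * a j * (starRingEnd ℂ) (a k) =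
      ∫ ω, ∑ j, ∑ k, (φ j k ω : ℂ) * a j * (starRingEnd ℂ) (a k) ∂μ := by
  have hint : ∀ j k, Integrable (fun ω => (φ j k ω : ℂ) * a j * (starRingEnd ℂ) (a k)) μ :=
    fun j k => ((hφ j k).ofReal.mul_const _).mul_const _
  rw [integral_finsetSum _ fun j _ => integrable_finsetSum _ fun k _ => hint j k]
  refine Finset.sum_congr rfl fun j _ => ?_
  rw [integral_finsetSum _ fun k _ => hint j k]
  refine Finset.sum_congr rfl fun k _ => ?_
  rw [integral_mul_const, integral_mul_const, integral_complex_ofReal]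

section Gaussian

variable {V : Type*} [NormedAddCommGroup V] [InnerProductSpace ℝ V]

/-- Translates of a Gaussian centred at distinct points are linearly independent. -/
lemma eq_zero_of_sum_gaussian_eq_zero {ι : Type*} [Fintype ι] {x : ι → V}
    (hx : Function.Injective x) {c : ℝ} (hc : 0 < c) {a : ι → ℂ}
    (h : ∀ w, ∑ j, (Real.exp (-c * ‖w - x j‖ ^ 2) : ℂ) * a j = 0) : a = 0 := by
  let χ : ι → (Multiplicative V →* ℂ) := fun j =>
    { toFun := fun w => (Real.exp (2 * c * inner ℝ (x j) w.toAdd) : ℂ)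
      map_one' := by simp
      map_mul' := fun v w => by
        rw [toAdd_mul, inner_add_right, mul_add, Real.exp_add, Complex.ofReal_mul] }
  have hχ : Function.Injective χ := fun j k hjk => by
    have h1 (w : V) : inner ℝ (x j) w = inner ℝ (x k) w := by
      have h2 : (Real.exp (2 * c * inner ℝ (x j) w) : ℂ) = Real.exp (2 * c * inner ℝ (x k) w) :=
        DFunLike.congr_fun hjk (Multiplicative.ofAdd w)
      have h3 := Real.exp_injective (Complex.ofReal_injective h2)
      exact mul_left_cancel₀ (by positivity) h3
    exact hx (ext_inner_right ℝ h1)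
  have hli := (linearIndependent_monoidHom (Multiplicative V) ℂ).comp χ hχ
  rw [Fintype.linearIndependent_iff] at hli
  have key := hli (fun j => (Real.exp (-c * ‖x j‖ ^ 2) : ℂ) * a j) (by
    funext w
    have hw := h w.toAdd
    have hsplit : ∀ j, (Real.exp (-c * ‖w.toAdd - x j‖ ^ 2) : ℂ) * a j =
        Real.exp (-c * ‖w.toAdd‖ ^ 2) *
          ((Real.exp (-c * ‖x j‖ ^ 2) : ℂ) * a j * χ j w) := fun j => by
      have : -c * ‖w.toAdd - x j‖ ^ 2 = -c * ‖w.toAdd‖ ^ 2 + -c * ‖x j‖ ^ 2 +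
          2 * c * inner ℝ (x j) w.toAdd := by
        rw [norm_sub_sq_real, real_inner_comm]; ring
      rw [this, Real.exp_add, Real.exp_add]
      simp only [χ, MonoidHom.coe_mk, OneHom.coe_mk, Complex.ofReal_mul]
      ring
    rw [Finset.sum_congr rfl fun j _ => hsplit j, ← Finset.mul_sum] at hw
    have hne : (Real.exp (-c * ‖w.toAdd‖ ^ 2) : ℂ) ≠ 0 :=
      Complex.ofReal_ne_zero.2 (Real.exp_pos _).ne'
    simpa using (mul_eq_zero.1 hw).resolve_left hne)
  funext j
  exact (mul_eq_zero.1 (key j)).resolve_left (Complex.ofReal_ne_zero.2 (Real.exp_pos _).ne')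

lemma gaussian_mul_gaussian (c : ℝ) (x y w : V) :
    Real.exp (-(2 * c) * ‖w - x‖ ^ 2) * Real.exp (-(2 * c) * ‖w - y‖ ^ 2) =
      Real.exp (-c * ‖x - y‖ ^ 2) * Real.exp (-(4 * c) * ‖w - (2⁻¹ : ℝ) • (x + y)‖ ^ 2) := by
  rw [← Real.exp_add, ← Real.exp_add]
  congr 1
  simp only [norm_sub_sq_real, norm_smul, mul_pow, norm_add_sq_real, inner_smul_right,
    inner_add_right]
  norm_num
  ring

variable [FiniteDimensional ℝ V] [MeasurableSpace V] [BorelSpace V]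

lemma integrable_gaussian_sub {c : ℝ} (hc : 0 < c) (y : V) :
    Integrable (fun w : V => Real.exp (-c * ‖w - y‖ ^ 2)) := by
  have h := GaussianFourier.integrable_cexp_neg_mul_sq_norm_add (V := V) (b := (c : ℂ)) (by simpa using hc) 0 0
  have h2 : Integrable (fun w : V => Real.exp (-c * ‖w‖ ^ 2)) := by
    refine h.re.congr (ae_of_all _ fun w => ?_)
    have : (-(c : ℂ) * (‖w‖ : ℂ) ^ 2 + 0 * ((inner ℝ (0 : V) w : ℝ) : ℂ)) =
        ((-c * ‖w‖ ^ 2 : ℝ) : ℂ) := by push_cast; ring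
    simp only [this]
    exact Complex.exp_ofReal_re _
  exact h2.comp_sub_right y

/-- The Gaussian kernel is strictly positive definite. -/
lemma gaussian_positive_definite {ι : Type*} [Fintype ι] {x : ι → V}
    (hx : Function.Injective x) {c : ℝ} (hc : 0 < c) {a : ι → ℂ} (ha : a ≠ 0) :
    ∃ r : ℝ, 0 < r ∧ ∑ j, ∑ k, (Real.exp (-c * ‖x j - x k‖ ^ 2) : ℂ) * a j *
      (starRingEnd ℂ) (a k) = r := by
  set F : V → ℂ := fun w => ∑ j, (Real.exp (-(2 * c) * ‖w - x j‖ ^ 2) : ℂ) * a j with hF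
  have hFc : Continuous F := by fun_prop
  set φ : ι → ι → V → ℝ := fun j k w =>
    Real.exp (-(2 * c) * ‖w - x j‖ ^ 2) * Real.exp (-(2 * c) * ‖w - x k‖ ^ 2) with hφ
  have hφi : ∀ j k, Integrable (φ j k) := fun j k => by
    simp only [hφ, gaussian_mul_gaussian]
    exact (integrable_gaussian_sub (by positivity) _).const_mul _
  set C : ℝ := ∫ w : V, Real.exp (-(4 * c) * ‖w‖ ^ 2) with hC
  have hCpos : 0 < C := by
    rw [hC, GaussianFourier.integral_rexp_neg_mul_sq_norm (by positivity)]
    positivity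
  have hφint : ∀ j k, ∫ w, φ j k w = C * Real.exp (-c * ‖x j - x k‖ ^ 2) := fun j k => by
    simp only [hφ, gaussian_mul_gaussian]
    rw [integral_const_mul, mul_comm,
      integral_sub_right_eq_self (fun w : V => Real.exp (-(4 * c) * ‖w‖ ^ 2))]
  have hquad : ∀ w, ∑ j, ∑ k, (φ j k w : ℂ) * a j * (starRingEnd ℂ) (a k) =
      ((‖F w‖ ^ 2 : ℝ) : ℂ) := fun w => by
    rw [Complex.ofReal_pow, ← Complex.mul_conj', hF]
    simp only [map_sum, Finset.sum_mul_sum]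
    refine Finset.sum_congr rfl fun j _ => Finset.sum_congr rfl fun k _ => ?_
    simp only [hφ, map_mul, Complex.conj_ofReal, Complex.ofReal_mul]
    ring
  have hsum := sum_integral_kernel hφi a
  simp only [hquad, integral_complex_ofReal, hφint] at hsum
  have hFi : Integrable fun w => ‖F w‖ ^ 2 := by
    have : Integrable fun w => ∑ j, ∑ k, (φ j k w : ℂ) * a j * (starRingEnd ℂ) (a k) :=
      integrable_finsetSum _ fun j _ => integrable_finsetSum _ fun k _ =>
        ((hφi j k).ofReal.mul_const _).mul_const _
    simp only [hquad] at this
    exact this.re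
  obtain ⟨w₀, hw₀⟩ : ∃ w, F w ≠ 0 := by
    by_contra! h
    exact ha (eq_zero_of_sum_gaussian_eq_zero hx (by positivity) h)
  have hpos : 0 < ∫ w, ‖F w‖ ^ 2 := by
    rw [integral_pos_iff_support_of_nonneg (fun w => by positivity) hFi]
    exact (hFc.norm.pow 2).isOpen_support.measure_pos _ ⟨w₀, by simpa using hw₀⟩
  refine ⟨(∫ w, ‖F w‖ ^ 2) / C, div_pos hpos hCpos, ?_⟩
  rw [Complex.ofReal_div, ← hsum, eq_div_iff (Complex.ofReal_ne_zero.2 hCpos.ne'),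
    Finset.sum_mul]
  refine Finset.sum_congr rfl fun j _ => ?_
  rw [Finset.sum_mul]
  refine Finset.sum_congr rfl fun k _ => ?_
  push_cast
  ring

end Gaussian

lemma integrable_exp_mul_sub_exp {α : ℝ} (hα : 0 < α) :
    Integrable (fun u : ℝ => Real.exp (α * u - Real.exp u)) := by
  have h := Real.GammaIntegral_convergent hα
  rw [← Real.range_exp, ← image_univ, integrableOn_image_iff_integrableOn_abs_deriv_smul
    MeasurableSet.univ (fun u _ => (Real.hasDerivAt_exp u).hasDerivWithinAt)
    Real.exp_injective.injOn, integrableOn_univ] at h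
  refine h.congr (ae_of_all _ fun u => ?_)
  simp only [abs_of_pos (Real.exp_pos u), smul_eq_mul, ← Real.exp_mul, ← Real.exp_add]
  congr 1
  ring

lemma Gamma_eq_integral_exp {α : ℝ} (hα : 0 < α) :
    Real.Gamma α = ∫ u : ℝ, Real.exp (α * u - Real.exp u) := by
  rw [Real.Gamma_eq_integral hα, ← Real.range_exp, ← image_univ,
    integral_image_eq_integral_abs_deriv_smul MeasurableSet.univ
      (fun u _ => (Real.hasDerivAt_exp u).hasDerivWithinAt) Real.exp_injective.injOn,
    setIntegral_univ]
  refine integral_congr_ae (ae_of_all _ fun u => ?_)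
  simp only [abs_of_pos (Real.exp_pos u), smul_eq_mul, ← Real.exp_mul, ← Real.exp_add]
  congr 1
  ring

/-- The Matérn function is a mixture of Gaussians. -/
lemma matern_eq_integral {α z : ℝ} (hα : 0 < α) (hz : 0 ≤ z) :
    matern α z = (Real.Gamma α)⁻¹ *
      ∫ u : ℝ, Real.exp (α * u - Real.exp u) * Real.exp (-(Real.exp (-u) / 4) * z ^ 2) := by
  have hΓ := Real.Gamma_pos_of_pos hα
  rcases hz.eq_or_lt with rfl | hz
  · simp [matern, ← Gamma_eq_integral_exp hα, hΓ.ne']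
  · set I : ℝ :=
      ∫ u : ℝ, Real.exp (α * u - Real.exp u) * Real.exp (-(Real.exp (-u) / 4) * z ^ 2) with hI
    have hK : matK α z = 1 / 2 * ((z / 2) ^ (-α) * I) := by
      rw [matK, ← integral_sub_left_eq_self (fun t => Real.exp (-z * Real.cosh t - α * t)) volume
        (Real.log (z / 2)), hI, ← integral_const_mul ((z / 2) ^ (-α))]
      congr 1
      refine integral_congr_ae (ae_of_all _ fun u => ?_)
      simp only [Real.rpow_def_of_pos (half_pos hz), ← Real.exp_add]
      congr 1
      rw [Real.cosh_eq, neg_sub, Real.exp_sub, Real.exp_sub, Real.exp_log (half_pos hz),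
        Real.exp_neg]
      field_simp
      ring
    rw [matern, if_neg hz.ne', hK, Real.div_rpow hz.le zero_le_two, Real.rpow_neg hz.le,
      Real.rpow_neg zero_le_two, Real.rpow_sub zero_lt_two, Real.rpow_one]
    have h1 := Real.rpow_pos_of_pos hz α
    have h2 := Real.rpow_pos_of_pos zero_lt_two α
    field_simp

theorem matern_positive_definite (α : ℝ) (hα : 0 < α) (n : ℕ) (hn : 0 < n) (N : ℕ)
    (x : Fin N → EuclideanSpace ℝ (Fin n)) (hx : Function.Injective x)
    (a : Fin N → ℂ) (ha : a ≠ 0) :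
    (∑ j, ∑ k, (matern α ‖x j - x k‖ : ℂ) * a j * (starRingEnd ℂ) (a k)).im = 0 ∧
      0 < (∑ j, ∑ k, (matern α ‖x j - x k‖ : ℂ) * a j * (starRingEnd ℂ) (a k)).re := by
  have hΓ := Real.Gamma_pos_of_pos hα
  set φ : Fin N → Fin N → ℝ → ℝ := fun j k u =>
    Real.exp (α * u - Real.exp u) * Real.exp (-(Real.exp (-u) / 4) * ‖x j - x k‖ ^ 2) with hφ
  have hφi : ∀ j k, Integrable (φ j k) := fun j k => by
    refine (integrable_exp_mul_sub_exp hα).mono' (by fun_prop) (ae_of_all _ fun u => ?_)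
    rw [Real.norm_of_nonneg (by positivity)]
    refine mul_le_of_le_one_right (by positivity) (Real.exp_le_one_iff.2 ?_)
    rw [neg_mul, neg_nonpos]
    positivity
  choose r hr hrsum using fun u : ℝ =>
    gaussian_positive_definite hx (c := Real.exp (-u) / 4) (by positivity) ha
  have hquad : ∀ u, ∑ j, ∑ k, (φ j k u : ℂ) * a j * (starRingEnd ℂ) (a k) =
      ((Real.exp (α * u - Real.exp u) * r u : ℝ) : ℂ) := fun u => by
    rw [Complex.ofReal_mul, ← hrsum u]
    simp only [hφ, Finset.mul_sum, Complex.ofReal_mul, mul_assoc]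
  have hri : Integrable fun u => Real.exp (α * u - Real.exp u) * r u := by
    have : Integrable fun u => ∑ j, ∑ k, (φ j k u : ℂ) * a j * (starRingEnd ℂ) (a k) :=
      integrable_finsetSum _ fun j _ => integrable_finsetSum _ fun k _ =>
        ((hφi j k).ofReal.mul_const _).mul_const _
    simp only [hquad] at this
    exact this.re
  have hsum : ∑ j, ∑ k, (matern α ‖x j - x k‖ : ℂ) * a j * (starRingEnd ℂ) (a k) =
      (((Real.Gamma α)⁻¹ * ∫ u, Real.exp (α * u - Real.exp u) * r u : ℝ) : ℂ) := by
    have h := sum_integral_kernel hφi a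
    simp only [hquad, integral_complex_ofReal] at h
    rw [Complex.ofReal_mul, ← h]
    simp only [matern_eq_integral hα (norm_nonneg _), hφ, Finset.mul_sum, Complex.ofReal_mul,
      mul_assoc]
  have hpos : 0 < ∫ u, Real.exp (α * u - Real.exp u) * r u := by
    have hp : ∀ u, 0 < Real.exp (α * u - Real.exp u) * r u :=
      fun u => mul_pos (Real.exp_pos _) (hr u)
    rw [integral_pos_iff_support_of_nonneg (fun u => (hp u).le) hri,
      Function.support_eq_univ fun u => (hp u).ne']
    simp
  rw [hsum, Complex.ofReal_im, Complex.ofReal_re]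
  exact ⟨rfl, by positivity⟩
end

section
/- For all real numbers λ > ρ > −1 and every r ≥ 0, one has Ω_λ(r) = (2 / B(ρ+1, λ−ρ)) ∫₀^1 Ω_ρ(r t) (1 − t²)^{λ−ρ−1} t^{2ρ+1} dt, where B denotes the Euler Beta function. -/
open MeasureTheory Real Set

/-- The kernel `Ω_λ` of the Hankel–Schoenberg transform. -/
noncomputable def matOmega (l t : ℝ) : ℝ :=
  Real.Gamma (l + 1) *
    ∑' k : ℕ, ((-1 : ℝ) ^ k / (Nat.factorial k * Real.Gamma (l + k + 1))) * (t / 2) ^ (2 * k)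

/-- The Euler Beta function. -/
noncomputable def matBeta (a b : ℝ) : ℝ :=
  ∫ t in (0 : ℝ)..1, t ^ (a - 1) * (1 - t) ^ (b - 1)

/-- The integrand of the Euler Beta function is integrable on the unit interval. -/
lemma integrableOn_rpow_mul_one_sub_rpow {a b : ℝ} (ha : 0 < a) (hb : 0 < b) :
    IntegrableOn (fun t : ℝ ↦ t ^ (a - 1) * (1 - t) ^ (b - 1)) (Ioo 0 1) := by
  have h := Complex.betaIntegral_convergent (u := (a : ℂ)) (v := (b : ℂ)) (by simpa) (by simpa)
  rw [intervalIntegrable_iff_integrableOn_Ioo_of_le zero_le_one] at h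
  refine (integrableOn_congr_fun (fun t ht ↦ ?_) measurableSet_Ioo).mp h.re
  change (((t : ℂ) ^ ((a : ℂ) - 1) * (1 - (t : ℂ)) ^ ((b : ℂ) - 1))).re = _
  have h₁ : (t : ℂ) ^ ((a : ℂ) - 1) = ((t ^ (a - 1) : ℝ) : ℂ) := by
    rw [Complex.ofReal_cpow ht.1.le]; push_cast; rfl
  have h₂ : (1 - (t : ℂ)) ^ ((b : ℂ) - 1) = (((1 - t) ^ (b - 1) : ℝ) : ℂ) := by
    rw [Complex.ofReal_cpow (sub_pos.mpr ht.2).le]; push_cast; rfl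
  rw [h₁, h₂, ← Complex.ofReal_mul, Complex.ofReal_re]

/-- The Euler Beta function in terms of the Gamma function. -/
lemma matBeta_eq_Gamma {a b : ℝ} (ha : 0 < a) (hb : 0 < b) :
    matBeta a b = Real.Gamma a * Real.Gamma b / Real.Gamma (a + b) := by
  have h : Complex.betaIntegral a b = (matBeta a b : ℂ) := by
    rw [Complex.betaIntegral, matBeta, ← intervalIntegral.integral_ofReal]
    refine intervalIntegral.integral_congr fun t ht ↦ ?_
    rw [uIcc_of_le zero_le_one] at ht
    simp only [Complex.ofReal_mul]
    rw [Complex.ofReal_cpow ht.1, Complex.ofReal_cpow (sub_nonneg.mpr ht.2)]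
    push_cast
    rfl
  rw [Complex.betaIntegral_eq_Gamma_mul_div _ _ (by simpa) (by simpa), ← Complex.ofReal_add,
    Complex.Gamma_ofReal, Complex.Gamma_ofReal, Complex.Gamma_ofReal] at h
  exact_mod_cast h.symm

lemma image_sq_Ioo_zero_one : (fun t : ℝ ↦ t ^ 2) '' Ioo 0 1 = Ioo 0 1 := by
  ext x
  constructor
  · rintro ⟨t, ⟨h₀, h₁⟩, rfl⟩
    exact ⟨by positivity, by dsimp only; nlinarith⟩
  · rintro ⟨h₀, h₁⟩
    exact ⟨√x, ⟨Real.sqrt_pos.mpr h₀, (Real.sqrt_lt' one_pos).mpr (by simpa)⟩, Real.sq_sqrt h₀.le⟩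

lemma injOn_sq_Ioo_zero_one : InjOn (fun t : ℝ ↦ t ^ 2) (Ioo 0 1) :=
  fun _ hx _ hy h ↦ (sq_eq_sq₀ hx.1.le hy.1.le).mp h

lemma hasDerivWithinAt_sq (s : Set ℝ) (t : ℝ) :
    HasDerivWithinAt (fun t : ℝ ↦ t ^ 2) (2 * t) s t := by
  simpa using (hasDerivAt_pow 2 t).hasDerivWithinAt

lemma abs_two_mul_smul_comp_sq (a b : ℝ) {t : ℝ} (ht : t ∈ Ioo (0 : ℝ) 1) :
    |2 * t| • ((t ^ 2) ^ (a - 1) * (1 - t ^ 2) ^ (b - 1)) =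
      2 * ((1 - t ^ 2) ^ (b - 1) * t ^ (2 * a - 1)) := by
  have h : (t ^ 2) ^ (a - 1) * t = t ^ (2 * a - 1) := by
    rw [← Real.rpow_natCast, ← Real.rpow_mul ht.1.le, ← Real.rpow_add_one ht.1.ne']
    congr 1
    push_cast
    ring
  rw [abs_of_pos (by linarith [ht.1]), smul_eq_mul, ← h]
  ring

/-- Integrability of the Beta integrand after the substitution `t ↦ t ^ 2`. -/
lemma integrableOn_one_sub_sq_rpow_mul_rpow {a b : ℝ} (ha : 0 < a) (hb : 0 < b) :
    IntegrableOn (fun t : ℝ ↦ (1 - t ^ 2) ^ (b - 1) * t ^ (2 * a - 1)) (Ioo 0 1) := by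
  have h := integrableOn_rpow_mul_one_sub_rpow ha hb
  rw [← image_sq_Ioo_zero_one, integrableOn_image_iff_integrableOn_abs_deriv_smul measurableSet_Ioo
    (fun t _ ↦ hasDerivWithinAt_sq _ t) injOn_sq_Ioo_zero_one,
    integrableOn_congr_fun (fun t ht ↦ abs_two_mul_smul_comp_sq a b ht) measurableSet_Ioo] at h
  simpa [IntegrableOn] using h.const_mul (1 / 2)

/-- The Beta integral after the substitution `t ↦ t ^ 2`. -/
lemma integral_one_sub_sq_rpow_mul_rpow (a b : ℝ) :
    ∫ t in Ioo (0 : ℝ) 1, (1 - t ^ 2) ^ (b - 1) * t ^ (2 * a - 1) = matBeta a b / 2 := by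
  have h : matBeta a b =
      ∫ t in Ioo (0 : ℝ) 1, 2 * ((1 - t ^ 2) ^ (b - 1) * t ^ (2 * a - 1)) := by
    rw [matBeta, intervalIntegral.integral_of_le zero_le_one, integral_Ioc_eq_integral_Ioo,
      ← image_sq_Ioo_zero_one, integral_image_eq_integral_abs_deriv_smul measurableSet_Ioo
      (fun t _ ↦ hasDerivWithinAt_sq _ t) injOn_sq_Ioo_zero_one, image_sq_Ioo_zero_one]
    exact setIntegral_congr_fun measurableSet_Ioo fun t ht ↦ abs_two_mul_smul_comp_sq a b ht
  rw [h, integral_const_mul]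
  ring

/-- The power series defining `Ω_λ` converges absolutely everywhere. -/
lemma summable_pow_div_factorial_mul_Gamma {l : ℝ} (hl : -1 < l) {x : ℝ} (hx : 0 ≤ x) :
    Summable fun k : ℕ ↦ x ^ k / (Nat.factorial k * Real.Gamma (l + k + 1)) := by
  refine summable_of_ratio_norm_eventually_le (r := 1 / 2) (by norm_num) ?_
  filter_upwards [Filter.eventually_ge_atTop (max 1 ⌈2 * x⌉₊)] with k hk
  have hk₁ : (1 : ℝ) ≤ k := by exact_mod_cast (le_max_left _ _).trans hk
  have hk₂ : 2 * x ≤ k := (Nat.le_ceil _).trans (by exact_mod_cast (le_max_right _ _).trans hk)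
  have hpos : 0 < l + k + 1 := by linarith
  have hΓ : 0 < Real.Gamma (l + k + 1) := Real.Gamma_pos_of_pos hpos
  have hrec : Real.Gamma (l + (k + 1 : ℕ) + 1) = (l + k + 1) * Real.Gamma (l + k + 1) := by
    rw [← Real.Gamma_add_one hpos.ne']
    congr 1
    push_cast
    ring
  rw [hrec, Nat.factorial_succ, Real.norm_of_nonneg (by positivity),
    Real.norm_of_nonneg (by positivity)]
  have hratio : x / ((k + 1) * (l + k + 1)) ≤ 1 / 2 := by
    rw [div_le_div_iff₀ (by positivity) two_pos]
    nlinarith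
  calc
    _ = x / ((k + 1) * (l + k + 1)) *
        (x ^ k / (Nat.factorial k * Real.Gamma (l + k + 1))) := by
      push_cast
      field_simp
      ring
    _ ≤ _ := by gcongr

theorem omega_order_lowering (l ρ : ℝ) (hρ : -1 < ρ) (hl : ρ < l) (r : ℝ) (hr : 0 ≤ r) :
    matOmega l r =
      (2 / matBeta (ρ + 1) (l - ρ)) *
        ∫ t in (0 : ℝ)..1, matOmega ρ (r * t) * (1 - t ^ 2) ^ (l - ρ - 1) * t ^ (2 * ρ + 1) := by
  have hb : 0 < l - ρ := sub_pos.mpr hl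
  have ha (k : ℕ) : 0 < ρ + k + 1 := by
    have : (0 : ℝ) ≤ k := k.cast_nonneg
    linarith
  have hΓρ (k : ℕ) : 0 < Real.Gamma (ρ + k + 1) := Real.Gamma_pos_of_pos (ha k)
  have hΓl (k : ℕ) : 0 < Real.Gamma (l + k + 1) :=
    Real.Gamma_pos_of_pos (by linarith [ha k])
  have hΓb : 0 < Real.Gamma (l - ρ) := Real.Gamma_pos_of_pos hb
  have hbeta (k : ℕ) : matBeta (ρ + k + 1) (l - ρ) =
      Real.Gamma (ρ + k + 1) * Real.Gamma (l - ρ) / Real.Gamma (l + k + 1) := by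
    rw [matBeta_eq_Gamma (ha k) hb]
    congr 2
    ring
  let c (k : ℕ) : ℝ := (-1) ^ k / (Nat.factorial k * Real.Gamma (ρ + k + 1)) * (r / 2) ^ (2 * k)
  let w (k : ℕ) (t : ℝ) : ℝ := (1 - t ^ 2) ^ (l - ρ - 1) * t ^ (2 * (ρ + k + 1) - 1)
  have hterm (k : ℕ) : c k * (matBeta (ρ + k + 1) (l - ρ) / 2) = Real.Gamma (l - ρ) / 2 *
      ((-1) ^ k / (Nat.factorial k * Real.Gamma (l + k + 1)) * (r / 2) ^ (2 * k)) := by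
    have h₁ := (hΓρ k).ne'
    have h₂ := (hΓl k).ne'
    rw [hbeta]
    simp only [c]
    field_simp
  have hw_int (k : ℕ) : Integrable (w k) (volume.restrict (Ioo 0 1)) :=
    integrableOn_one_sub_sq_rpow_mul_rpow (ha k) hb
  have hw_nonneg (k : ℕ) {t : ℝ} (ht : t ∈ Ioo (0 : ℝ) 1) : 0 ≤ w k t :=
    mul_nonneg (Real.rpow_nonneg (by nlinarith [ht.1, ht.2]) _) (Real.rpow_nonneg ht.1.le _)
  have hw (k : ℕ) : ∫ t in Ioo (0 : ℝ) 1, w k t = matBeta (ρ + k + 1) (l - ρ) / 2 :=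
    integral_one_sub_sq_rpow_mul_rpow _ _
  have hnorm (k : ℕ) : ∫ t in Ioo (0 : ℝ) 1, ‖c k * w k t‖ = Real.Gamma (l - ρ) / 2 *
      (((r / 2) ^ 2) ^ k / (Nat.factorial k * Real.Gamma (l + k + 1))) := by
    have habs : ∫ t in Ioo (0 : ℝ) 1, ‖c k * w k t‖ = ‖c k‖ * ∫ t in Ioo (0 : ℝ) 1, w k t := by
      rw [← integral_const_mul]
      refine setIntegral_congr_fun measurableSet_Ioo fun t ht ↦ ?_
      simp only [norm_mul, Real.norm_of_nonneg (hw_nonneg k ht)]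
    have hβ : 0 < matBeta (ρ + k + 1) (l - ρ) := by
      have := hΓρ k
      have := hΓl k
      rw [hbeta]
      positivity
    rw [habs, hw, ← Real.norm_of_nonneg (half_pos hβ).le, ← norm_mul, hterm]
    simp [abs_of_pos (hΓl k), abs_of_pos hΓb, hΓb.ne', pow_mul, abs_of_nonneg hr]
    ring
  have hsum := integral_tsum_of_summable_integral_norm (F := fun k t ↦ c k * w k t)
    (fun k ↦ (hw_int k).const_mul (c k)) (by
      simp only [hnorm]
      exact (summable_pow_div_factorial_mul_Gamma (hρ.trans hl) (sq_nonneg _)).mul_left _)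
  simp only [integral_const_mul, hw, hterm, tsum_mul_left] at hsum
  have hint : ∫ t in (0 : ℝ)..1,
      matOmega ρ (r * t) * (1 - t ^ 2) ^ (l - ρ - 1) * t ^ (2 * ρ + 1) =
      Real.Gamma (ρ + 1) * ∫ t in Ioo (0 : ℝ) 1, ∑' k, c k * w k t := by
    rw [intervalIntegral.integral_of_le zero_le_one, integral_Ioc_eq_integral_Ioo,
      ← integral_const_mul]
    refine setIntegral_congr_fun measurableSet_Ioo fun t ht ↦ ?_
    simp only [matOmega]
    rw [mul_assoc, mul_assoc, ← tsum_mul_right]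
    congr 2
    funext k
    have hpow : t ^ (2 * (ρ + k + 1) - 1) = t ^ (2 * ρ + 1) * t ^ (2 * k) := by
      rw [← Real.rpow_add_natCast ht.1.ne']
      congr 1
      push_cast
      ring
    simp only [c, w, hpow, mul_div_right_comm r t 2, mul_pow]
    ring
  have hβ₀ : matBeta (ρ + 1) (l - ρ) =
      Real.Gamma (ρ + 1) * Real.Gamma (l - ρ) / Real.Gamma (l + 1) := by
    simpa using hbeta 0
  have h₁ : Real.Gamma (ρ + 1) ≠ 0 := by simpa using (hΓρ 0).ne'
  have h₂ : Real.Gamma (l + 1) ≠ 0 := by simpa using (hΓl 0).ne'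
  rw [hint, ← hsum, hβ₀, matOmega]
  field_simp
end

section
/- For every real number α and every β > |α|, one has ∫₀^∞ K_α(t) t^{β−1} dt = 2^{β−2} Γ((β+α)/2) Γ((β−α)/2). -/
open MeasureTheory Real Set

/-- Substitution `y = exp x` over the whole real line. -/
theorem integral_exp_mul_comp_exp (g : ℝ → ℝ) :
    ∫ x : ℝ, exp x * g (exp x) = ∫ y in Ioi (0 : ℝ), g y := by
  have h := integral_image_eq_integral_abs_deriv_smul MeasurableSet.univ
    (fun x _ ↦ (hasDerivAt_exp x).hasDerivWithinAt) exp_injective.injOn g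
  rw [image_univ, range_exp] at h
  simpa using h.symm

theorem integrable_exp_mul_comp_exp_iff (g : ℝ → ℝ) :
    Integrable (fun x : ℝ ↦ exp x * g (exp x)) ↔ IntegrableOn g (Ioi 0) := by
  have h := integrableOn_image_iff_integrableOn_abs_deriv_smul MeasurableSet.univ
    (fun x _ ↦ (hasDerivAt_exp x).hasDerivWithinAt) exp_injective.injOn g
  rw [image_univ, range_exp] at h
  simpa using h.symm

theorem exp_mul_Gamma_integrand_comp_exp (s x : ℝ) :
    exp x * (exp (-exp x) * exp x ^ (s - 1)) = exp (s * x - exp x) := by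
  rw [← exp_mul, ← exp_add, ← exp_add]
  ring_nf

theorem integral_exp_mul_sub_exp {s : ℝ} (hs : 0 < s) :
    ∫ x : ℝ, exp (s * x - exp x) = Real.Gamma s := by
  simp only [Gamma_eq_integral hs, ← integral_exp_mul_comp_exp, exp_mul_Gamma_integrand_comp_exp]

theorem integrable_exp_mul_sub_exp_s5 {s : ℝ} (hs : 0 < s) :
    Integrable fun x : ℝ ↦ exp (s * x - exp x) := by
  simpa only [← integrable_exp_mul_comp_exp_iff, exp_mul_Gamma_integrand_comp_exp]
    using GammaIntegral_convergent hs

/-- Schläfli's integral at `exp v`, translated so that the two exponentials making up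
`cosh` separate. -/
theorem matK_exp (a v : ℝ) :
    matK a (exp v) = (1 / 2) *
      ∫ t : ℝ, exp (-exp t - exp (2 * v - (t + 2 * log 2)) - a * (t - (v - log 2))) := by
  rw [matK, ← integral_sub_right_eq_self _ (v - log 2)]
  congr 2 with t
  congr 1
  have h₁ : exp (t - (v - log 2)) = 2 * exp t / exp v := by
    rw [exp_sub, exp_sub, exp_log two_pos]
    field_simp
  have h₂ : exp (-(t - (v - log 2))) = exp v / (2 * exp t) := by
    rw [exp_neg, h₁, inv_div]
  have h₃ : exp (2 * v - (t + 2 * log 2)) = exp v ^ 2 / (4 * exp t) := by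
    rw [exp_sub, exp_add, two_mul, two_mul, exp_add, exp_add, exp_log two_pos]
    ring
  rw [cosh_eq, h₁, h₂, h₃]
  field_simp
  ring

theorem exp_mellin_integrand_eq (α β v t : ℝ) :
    exp (-exp t - exp (2 * v - (t + 2 * log 2)) - α * (t - (v - log 2)) + β * v) =
      2 ^ β * exp ((β - α) / 2 * t - exp t) *
        exp ((β + α) / 2 * (2 * v - (t + 2 * log 2)) - exp (2 * v - (t + 2 * log 2))) := by
  rw [rpow_def_of_pos two_pos, ← exp_add, ← exp_add]
  ring_nf

theorem integral_comp_two_mul_sub (g : ℝ → ℝ) (c : ℝ) :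
    ∫ v : ℝ, g (2 * v - c) = (1 / 2) * ∫ u : ℝ, g u := by
  rw [Measure.integral_comp_mul_left (fun x ↦ g (x - c)) 2, integral_sub_right_eq_self]
  norm_num

theorem matK_mellin (α β : ℝ) (hβ : |α| < β) :
    (∫ t in Ioi (0 : ℝ), matK α t * t ^ (β - 1)) =
      (2 : ℝ) ^ (β - 2) * Real.Gamma ((β + α) / 2) * Real.Gamma ((β - α) / 2) := by
  obtain ⟨h₁, h₂⟩ := abs_lt.mp hβ
  have ha : 0 < (β + α) / 2 := by linarith
  have hb : 0 < (β - α) / 2 := by linarith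
  let F : ℝ → ℝ → ℝ := fun v t ↦
    exp (-exp t - exp (2 * v - (t + 2 * log 2)) - α * (t - (v - log 2)) + β * v)
  have hF (t : ℝ) : ∫ v, F v t =
      2 ^ β * exp ((β - α) / 2 * t - exp t) * ((1 / 2) * Real.Gamma ((β + α) / 2)) := by
    simp only [F, exp_mellin_integrand_eq]
    rw [integral_const_mul,
      integral_comp_two_mul_sub (fun u ↦ exp ((β + α) / 2 * u - exp u)),
      integral_exp_mul_sub_exp ha]
  have hint : Integrable (Function.uncurry F) (volume.prod volume) := by
    have hcont : Continuous (Function.uncurry F) := by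
      simp only [F, Function.uncurry_def]
      fun_prop
    rw [integrable_prod_iff' hcont.aestronglyMeasurable]
    constructor
    · refine .of_forall fun t ↦ ?_
      simp only [Function.uncurry, F, exp_mellin_integrand_eq]
      exact (((integrable_exp_mul_sub_exp_s5 ha).comp_sub_right (t + 2 * log 2)).comp_mul_left'
        two_ne_zero).const_mul _
    · have hnorm (v t : ℝ) : ‖F v t‖ = F v t := by simp [F]
      simp only [Function.uncurry, hnorm, hF]
      exact ((integrable_exp_mul_sub_exp_s5 hb).const_mul _).mul_const _
  calc ∫ t in Ioi (0 : ℝ), matK α t * t ^ (β - 1)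
      = ∫ v : ℝ, (1 / 2) * ∫ t : ℝ, F v t := by
        rw [← integral_exp_mul_comp_exp]
        congr! 2 with v
        have hv : exp (β * v) = exp v * exp v ^ (β - 1) := by
          rw [← exp_mul, ← exp_add]
          ring_nf
        simp only [F, exp_add _ (β * v)]
        rw [integral_mul_const, matK_exp, hv]
        ring
    _ = (1 / 2) * ∫ t : ℝ, ∫ v : ℝ, F v t := by
        rw [integral_const_mul, integral_integral_swap hint]
    _ = 2 ^ (β - 2) * Real.Gamma ((β + α) / 2) * Real.Gamma ((β - α) / 2) := by
        simp only [hF]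
        rw [integral_mul_const, integral_const_mul, integral_exp_mul_sub_exp hb,
          rpow_sub two_pos]
        norm_num
        ring
end

section
/- Let λ > −1 and let α be real with α + λ + 1 > 0. Then for every r ≥ 0, (1 + r²)^{−α−λ−1} = (1 / (2^{α+2λ} Γ(λ+1) Γ(α+λ+1))) ∫₀^∞ Ω_λ(r t) K_α(t) t^{α+2λ+1} dt. -/
open MeasureTheory Real Set

/-- The series `∑ (-x)ᵏ / (k! Γ(l + k + 1))`, a Bessel–Clifford function at `-x`. -/
noncomputable def besselClifford (l x : ℝ) : ℝ :=
  ∑' k : ℕ, ((-1 : ℝ) ^ k / (Nat.factorial k * Real.Gamma (l + k + 1))) * x ^ k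

lemma matOmega_eq (l t : ℝ) :
    matOmega l t = Real.Gamma (l + 1) * besselClifford l ((t / 2) ^ 2) := by
  simp only [matOmega, besselClifford, pow_mul]

lemma exists_inv_Gamma_add_natCast_le {l : ℝ} (hl : -1 < l) :
    ∃ M : ℝ, ∀ k : ℕ, (Real.Gamma (l + k + 1))⁻¹ ≤ M := by
  refine ⟨max (Real.Gamma (l + 1))⁻¹ (Real.Gamma (l + 1 + 1))⁻¹, fun k => ?_⟩
  rcases k with _ | k
  · simp
  · refine le_trans ?_ (le_max_right _ _)
    induction k with
    | zero => simp
    | succ k ih =>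
      refine le_trans ?_ ih
      have hk : (0 : ℝ) ≤ k := k.cast_nonneg
      have h1 : 1 ≤ l + ((k + 1 : ℕ) : ℝ) + 1 := by push_cast; linarith
      have h2 : l + ((k + 1 + 1 : ℕ) : ℝ) + 1 = (l + ((k + 1 : ℕ) : ℝ) + 1) + 1 := by
        push_cast; ring
      rw [h2, Real.Gamma_add_one (by positivity)]
      have hG : 0 < Real.Gamma (l + ((k + 1 : ℕ) : ℝ) + 1) := Real.Gamma_pos_of_pos (by positivity)
      exact inv_anti₀ hG (le_mul_of_one_le_left hG.le h1)

lemma exists_norm_besselClifford_coeff_le {l : ℝ} (hl : -1 < l) :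
    ∃ M : ℝ, ∀ k : ℕ,
      ‖(-1 : ℝ) ^ k / (Nat.factorial k * Real.Gamma (l + k + 1))‖ ≤ M / Nat.factorial k := by
  obtain ⟨M, hM⟩ := exists_inv_Gamma_add_natCast_le hl
  refine ⟨M, fun k => ?_⟩
  have hG : 0 < Real.Gamma (l + k + 1) :=
    Real.Gamma_pos_of_pos (by have := k.cast_nonneg (α := ℝ); linarith)
  rw [norm_div, norm_pow, norm_neg, norm_one, one_pow, norm_mul, Real.norm_of_nonneg hG.le,
    Real.norm_of_nonneg (by positivity), mul_comm, ← div_div, one_div]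
  gcongr
  exact hM k

lemma summable_besselClifford {l : ℝ} (hl : -1 < l) (x : ℝ) :
    Summable fun k : ℕ =>
      ((-1 : ℝ) ^ k / (Nat.factorial k * Real.Gamma (l + k + 1))) * x ^ k := by
  obtain ⟨M, hM⟩ := exists_norm_besselClifford_coeff_le hl
  refine Summable.of_norm_bounded ((Real.summable_pow_div_factorial |x|).mul_left M) fun k => ?_
  rw [norm_mul, norm_pow, Real.norm_eq_abs x]
  calc _ ≤ M / Nat.factorial k * |x| ^ k := by gcongr; exact hM k
    _ = _ := by ring

lemma besselClifford_coeff_succ (l : ℝ) (k : ℕ) :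
    ((-1 : ℝ) ^ (k + 1) / (Nat.factorial (k + 1) * Real.Gamma (l + (k + 1 : ℕ) + 1))) * (k + 1) =
      -((-1 : ℝ) ^ k / (Nat.factorial k * Real.Gamma (l + 1 + k + 1))) := by
  have : l + 1 + (k : ℝ) + 1 = l + (k + 1 : ℕ) + 1 := by push_cast; ring
  rw [this, Nat.factorial_succ, pow_succ, Nat.cast_mul]
  push_cast
  have h1 : (k : ℝ) + 1 ≠ 0 := by positivity
  rw [mul_assoc ((k : ℝ) + 1), mul_comm ((k : ℝ) + 1), div_mul_eq_mul_div,
    mul_div_mul_right _ _ h1]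
  ring

lemma hasDerivAt_besselClifford {l : ℝ} (hl : -1 < l) (x : ℝ) :
    HasDerivAt (besselClifford l) (-besselClifford (l + 1) x) x := by
  obtain ⟨M, hM⟩ := exists_norm_besselClifford_coeff_le (l := l + 1) (by linarith)
  set R := |x| + 1
  let c : ℕ → ℝ := fun k => (-1 : ℝ) ^ k / (Nat.factorial k * Real.Gamma (l + k + 1))
  let d : ℕ → ℝ := fun k => (-1 : ℝ) ^ k / (Nat.factorial k * Real.Gamma (l + 1 + k + 1))
  have hcd (k : ℕ) : c (k + 1) * (k + 1) = -d k := besselClifford_coeff_succ l k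
  have hdM (k : ℕ) : ‖d k‖ ≤ M / Nat.factorial k := hM k
  have hu : Summable fun k : ℕ => M * (R ^ k / Nat.factorial k) :=
    (Real.summable_pow_div_factorial R).mul_left M
  have hg : ∀ (k : ℕ) (y : ℝ), y ∈ Metric.ball (0 : ℝ) R →
      HasDerivAt (fun z => c (k + 1) * z ^ (k + 1)) (-(d k * y ^ k)) y := fun k y _ => by
    refine ((hasDerivAt_pow (k + 1) y).const_mul (c (k + 1))).congr_deriv ?_
    rw [← neg_mul, ← hcd]
    push_cast
    ring
  have key := hasDerivAt_tsum_of_isPreconnected (y₀ := 0) (y := x) hu Metric.isOpen_ball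
    (convex_ball (0 : ℝ) R).isPreconnected hg (fun k y hy => by
      have hyR : ‖y‖ ≤ R := by simpa using (mem_ball_zero_iff.1 hy).le
      rw [norm_neg, norm_mul, norm_pow]
      calc _ ≤ M / Nat.factorial k * R ^ k := by
            gcongr
            · exact (norm_nonneg _).trans (hdM k)
            · exact hdM k
        _ = _ := by ring) (Metric.mem_ball_self (by positivity)) (by simp)
        (by simp [R])
  rw [tsum_neg] at key
  refine ((key.const_add (c 0)).congr_of_eventuallyEq (.of_forall fun z => ?_))
  have := (summable_besselClifford hl z).tsum_eq_zero_add
  simpa [besselClifford, c] using this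

lemma besselClifford_contiguous {l : ℝ} (hl : -1 < l) (x : ℝ) :
    besselClifford l x =
      (l + 1) * besselClifford (l + 1) x - x * besselClifford (l + 2) x := by
  have e2 : l + 2 = l + 1 + 1 := by ring
  have s1 := summable_besselClifford (l := l + 1) (by linarith) x
  have s2 := summable_besselClifford (l := l + 1 + 1) (by linarith) x
  have s0 := summable_besselClifford hl x
  rw [e2]
  unfold besselClifford
  rw [s0.tsum_eq_zero_add, s1.tsum_eq_zero_add, mul_add, ← tsum_mul_left, ← tsum_mul_left,
    add_sub_assoc,
    ← (((summable_nat_add_iff 1).2 s1).mul_left (l + 1)).tsum_sub (s2.mul_left x)]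
  congr 1
  · have : 0 < Real.Gamma (l + 1) := Real.Gamma_pos_of_pos (by linarith)
    have h : l + 1 ≠ 0 := by linarith
    simp [Real.Gamma_add_one h]
    field_simp
  · refine tsum_congr fun k => ?_
    have hk := k.cast_nonneg (α := ℝ)
    have := besselClifford_coeff_succ (l + 1) k
    rw [neg_eq_iff_eq_neg.symm] at this
    rw [← this, show l + 1 + ((k + 1 : ℕ) : ℝ) + 1 = (l + ((k + 1 : ℕ) : ℝ) + 1) + 1 by ring,
      Real.Gamma_add_one (s := l + ((k + 1 : ℕ) : ℝ) + 1) (by push_cast; linarith)]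
    have hG : 0 < Real.Gamma (l + ((k + 1 : ℕ) : ℝ) + 1) :=
      Real.Gamma_pos_of_pos (by push_cast; linarith)
    have h1 : l + ((k + 1 : ℕ) : ℝ) + 1 ≠ 0 := by push_cast; linarith
    field_simp
    push_cast
    ring

lemma abs_besselClifford_le_of_neg_half_le {l : ℝ} (hl : -(1 / 2) ≤ l) {x : ℝ} (hx : 0 ≤ x) :
    |besselClifford l x| ≤ (Real.Gamma (l + 1))⁻¹ := by
  let E : ℝ → ℝ := fun y => besselClifford l y ^ 2 + y * besselClifford (l + 1) y ^ 2
  have hE (y : ℝ) : HasDerivAt E (-(2 * l + 1) * besselClifford (l + 1) y ^ 2) y := by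
    have h0 := hasDerivAt_besselClifford (l := l) (by linarith) y
    have h1 := hasDerivAt_besselClifford (l := l + 1) (by linarith) y
    refine ((h0.pow 2).add ((hasDerivAt_id y).mul (h1.pow 2))).congr_deriv ?_
    rw [besselClifford_contiguous (l := l) (by linarith) y, show l + 2 = l + 1 + 1 by ring]
    simp
    ring
  have hanti : Antitone E := antitone_of_deriv_nonpos (fun y => (hE y).differentiableAt)
    fun y => by rw [(hE y).deriv]; nlinarith [sq_nonneg (besselClifford (l + 1) y)]
  have h0 : besselClifford l 0 = (Real.Gamma (l + 1))⁻¹ := by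
    unfold besselClifford
    rw [tsum_eq_single 0 fun k hk => by simp [hk]]
    simp
  have hG : 0 < Real.Gamma (l + 1) := Real.Gamma_pos_of_pos (by linarith)
  refine abs_le_of_sq_le_sq ?_ (by positivity)
  have := hanti hx
  simp only [E, h0, zero_mul, add_zero] at this
  nlinarith [mul_nonneg hx (sq_nonneg (besselClifford (l + 1) x))]

lemma exists_abs_besselClifford_le {l : ℝ} (hl : -1 < l) :
    ∃ A B : ℝ, ∀ x : ℝ, 0 ≤ x → |besselClifford l x| ≤ A + B * x := by
  refine ⟨(l + 1) * (Real.Gamma (l + 1 + 1))⁻¹, (Real.Gamma (l + 2 + 1))⁻¹, fun x hx => ?_⟩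
  rw [besselClifford_contiguous hl x]
  refine (abs_sub _ _).trans ?_
  rw [abs_mul, abs_mul, abs_of_pos (by linarith : 0 < l + 1), abs_of_nonneg hx,
    mul_comm x]
  gcongr
  · linarith
  · exact abs_besselClifford_le_of_neg_half_le (by linarith) hx
  · exact abs_besselClifford_le_of_neg_half_le (by linarith) hx

lemma continuous_matOmega {l : ℝ} (hl : -1 < l) : Continuous (matOmega l) := by
  have h : Continuous (besselClifford l) :=
    continuous_iff_continuousAt.2 fun x => (hasDerivAt_besselClifford hl x).continuousAt
  rw [funext (matOmega_eq l)]
  fun_prop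

lemma exists_abs_matOmega_le {l : ℝ} (hl : -1 < l) :
    ∃ A B : ℝ, ∀ t : ℝ, |matOmega l t| ≤ A + B * t ^ 2 := by
  obtain ⟨A, B, h⟩ := exists_abs_besselClifford_le hl
  have hG : 0 < Real.Gamma (l + 1) := Real.Gamma_pos_of_pos (by linarith)
  refine ⟨Real.Gamma (l + 1) * A, Real.Gamma (l + 1) * B / 4, fun t => ?_⟩
  rw [matOmega_eq, abs_mul, abs_of_pos hG]
  calc _ ≤ Real.Gamma (l + 1) * (A + B * (t / 2) ^ 2) := by
        gcongr
        exact h _ (by positivity)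
    _ = _ := by ring

lemma matK_mul_rpow (α : ℝ) {z : ℝ} (hz : 0 < z) :
    matK α z * z ^ α =
      2 ^ (α - 1) * ∫ s in Ioi (0 : ℝ), s ^ (α - 1) * exp (-s) * exp (-(1 / (4 * s)) * z ^ 2) := by
  have himg : (fun u : ℝ => z / 2 * exp (-u)) '' univ = Ioi 0 := by
    ext s
    simp only [image_univ, mem_range, mem_Ioi]
    constructor
    · rintro ⟨u, rfl⟩
      positivity
    · intro hs
      refine ⟨-Real.log (2 / z * s), ?_⟩
      rw [neg_neg, Real.exp_log (by positivity)]
      field_simp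
  have hder (u : ℝ) (_ : u ∈ (univ : Set ℝ)) :
      HasDerivWithinAt (fun u : ℝ => z / 2 * exp (-u)) (-(z / 2 * exp (-u))) univ u := by
    refine ((((hasDerivAt_id u).neg).exp).const_mul (z / 2)).hasDerivWithinAt.congr_deriv ?_
    simp
  have hinj : InjOn (fun u : ℝ => z / 2 * exp (-u)) univ := by
    intro u _ v _ h
    have := mul_left_cancel₀ (by positivity) h
    simpa using this
  rw [← himg, integral_image_eq_integral_abs_deriv_smul MeasurableSet.univ hder hinj,
    setIntegral_univ, matK, mul_right_comm, ← integral_const_mul, ← integral_const_mul]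
  refine integral_congr_ae (.of_forall fun u => ?_)
  have h1 : (z / 2 * exp (-u)) * (z / 2 * exp (-u)) ^ (α - 1) =
      z ^ α / 2 ^ α * exp (-(α * u)) := by
    rw [Real.rpow_sub_one (by positivity), mul_div_cancel₀ _ (by positivity),
      Real.mul_rpow (by positivity) (by positivity), Real.div_rpow hz.le zero_le_two, ← Real.exp_mul]
    ring_nf
  have h2 : (2 : ℝ) ^ (α - 1) = 2 ^ α / 2 := by rw [Real.rpow_sub_one two_ne_zero]
  have h3 : exp (-(z / 2 * exp (-u))) * exp (-(1 / (4 * (z / 2 * exp (-u)))) * z ^ 2) =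
      exp (-z * cosh u) := by
    rw [← Real.exp_add, Real.cosh_eq, Real.exp_neg u]
    congr 1
    field_simp
    ring
  simp only [smul_eq_mul, abs_neg]
  rw [abs_of_pos (by positivity), sub_eq_add_neg, Real.exp_add, ← h3, mul_assoc (_ ^ _),
    ← mul_assoc (z / 2 * _), h1, h2]
  field_simp

lemma integral_rpow_mul_exp_neg_inv_mul_sq {q s : ℝ} (hq : -1 < q) (hs : 0 < s) :
    ∫ z in Ioi (0 : ℝ), z ^ q * exp (-(1 / (4 * s)) * z ^ 2) =
      1 / 2 * Real.Gamma ((q + 1) / 2) * (4 * s) ^ ((q + 1) / 2) := by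
  have := integral_rpow_mul_exp_neg_mul_rpow two_pos hq (b := 1 / (4 * s)) (by positivity)
  simp_rw [Real.rpow_two] at this
  rw [this, one_div, Real.inv_rpow (by positivity), ← Real.rpow_neg (by positivity)]
  ring_nf

lemma integrable_rpow_mul_exp_neg_inv_mul_sq {q s : ℝ} (hq : -1 < q) (hs : 0 < s) :
    IntegrableOn (fun z : ℝ => z ^ q * exp (-(1 / (4 * s)) * z ^ 2)) (Ioi 0) :=
  integrableOn_rpow_mul_exp_neg_mul_sq (by positivity) hq

/-- Weber's first exponential integral. -/
lemma integral_matOmega_mul_exp_neg_inv_mul_sq {l : ℝ} (hl : -1 < l) (r : ℝ) {s : ℝ} (hs : 0 < s) :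
    ∫ z in Ioi (0 : ℝ), matOmega l (r * z) * (z ^ (2 * l + 1) * exp (-(1 / (4 * s)) * z ^ 2)) =
      1 / 2 * Real.Gamma (l + 1) * (4 * s) ^ (l + 1) * exp (-(r ^ 2 * s)) := by
  let c : ℕ → ℝ := fun k =>
    (-1 : ℝ) ^ k / (Nat.factorial k * Real.Gamma (l + k + 1)) * ((r / 2) ^ 2) ^ k
  let F : ℕ → ℝ → ℝ := fun k z =>
    c k * (z ^ (2 * l + 1 + 2 * k) * exp (-(1 / (4 * s)) * z ^ 2))
  have hq (k : ℕ) : -1 < 2 * l + 1 + 2 * (k : ℝ) := by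
    have := k.cast_nonneg (α := ℝ); linarith
  have hG (k : ℕ) : 0 < Real.Gamma (l + k + 1) :=
    Real.Gamma_pos_of_pos (by have := hq k; linarith)
  have hint (k : ℕ) : ∫ z in Ioi (0 : ℝ), z ^ (2 * l + 1 + 2 * (k : ℝ)) *
      exp (-(1 / (4 * s)) * z ^ 2) =
      1 / 2 * Real.Gamma (l + k + 1) * (4 * s) ^ (l + 1) * (4 * s) ^ k := by
    rw [integral_rpow_mul_exp_neg_inv_mul_sq (hq k) hs,
      show (2 * l + 1 + 2 * (k : ℝ) + 1) / 2 = l + k + 1 by ring,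
      show l + (k : ℝ) + 1 = l + 1 + k by ring, Real.rpow_add_natCast (by positivity)]
    ring
  have hFi (k : ℕ) : IntegrableOn (F k) (Ioi 0) :=
    (integrable_rpow_mul_exp_neg_inv_mul_sq (hq k) hs).const_mul (c k)
  have hFn : Summable fun k => ∫ z in Ioi (0 : ℝ), ‖F k z‖ := by
    refine ((Real.summable_pow_div_factorial (r ^ 2 * s)).mul_left
      (1 / 2 * (4 * s) ^ (l + 1))).congr fun k => ?_
    have : ∀ z ∈ Ioi (0 : ℝ), ‖F k z‖ =
        |c k| * (z ^ (2 * l + 1 + 2 * (k : ℝ)) * exp (-(1 / (4 * s)) * z ^ 2)) := fun z hz => by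
      have hz : 0 < z := hz
      rw [norm_mul, Real.norm_eq_abs, Real.norm_of_nonneg (by positivity)]
    rw [setIntegral_congr_fun measurableSet_Ioi this, integral_const_mul, hint k, abs_mul, abs_div,
      abs_pow, abs_neg, abs_one, one_pow, abs_of_pos (mul_pos (by positivity) (hG k)),
      abs_of_nonneg (by positivity)]
    have := (hG k).ne'
    field_simp
    rw [← mul_pow]
    congr 1
    ring
  have hsum := hasSum_integral_of_summable_integral_norm hFi hFn
  have hexp : HasSum (fun k => ∫ z in Ioi (0 : ℝ), F k z)
      (1 / 2 * (4 * s) ^ (l + 1) * exp (-(r ^ 2 * s))) := by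
    have h := (NormedSpace.expSeries_div_hasSum_exp (-(r ^ 2 * s))).mul_left
      (1 / 2 * (4 * s) ^ (l + 1))
    rw [← Real.exp_eq_exp_ℝ] at h
    refine h.congr_fun fun k => ?_
    rw [integral_const_mul, hint k]
    have := (hG k).ne'
    simp only [c]
    field_simp
    rw [← mul_pow, ← mul_pow]
    congr 1
    ring
  rw [mul_right_comm (1 / 2 : ℝ), mul_right_comm, ← hsum.unique hexp, mul_comm _ (Real.Gamma _),
    ← integral_const_mul]
  refine setIntegral_congr_fun measurableSet_Ioi fun z hz => ?_
  have hz : 0 < z := hz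
  simp only [matOmega_eq, besselClifford, F, mul_assoc (Real.Gamma (l + 1))]
  rw [← tsum_mul_right]
  congr 1
  refine tsum_congr fun k => ?_
  rw [show (2 : ℝ) * k = ((2 * k : ℕ) : ℝ) by push_cast; ring, Real.rpow_add_natCast hz.ne',
    pow_mul, show (r * z / 2) ^ 2 = (r / 2) ^ 2 * z ^ 2 by ring, mul_pow]
  ring

lemma integrable_prod_rpow_mul_exp {q a : ℝ} (hq : -1 < q) (ha : 0 < a + (q + 1) / 2) :
    Integrable (fun p : ℝ × ℝ => p.1 ^ q *
      (p.2 ^ (a - 1) * exp (-p.2) * exp (-(1 / (4 * p.2)) * p.1 ^ 2)))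
      ((volume.restrict (Ioi 0)).prod (volume.restrict (Ioi 0))) := by
  have hmeas : Measurable fun p : ℝ × ℝ => p.1 ^ q *
      (p.2 ^ (a - 1) * exp (-p.2) * exp (-(1 / (4 * p.2)) * p.1 ^ 2)) := by fun_prop
  rw [integrable_prod_iff' hmeas.aestronglyMeasurable]
  constructor
  · refine (ae_restrict_iff' measurableSet_Ioi).2 (.of_forall fun s hs => ?_)
    refine ((integrable_rpow_mul_exp_neg_inv_mul_sq hq hs).const_mul
      (s ^ (a - 1) * exp (-s))).congr (.of_forall fun z => ?_)
    simp only
    ring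
  · have hI := (Real.GammaIntegral_convergent ha).const_mul
      (1 / 2 * Real.Gamma ((q + 1) / 2) * 4 ^ ((q + 1) / 2))
    refine IntegrableOn.congr_fun hI (fun s hs => ?_) measurableSet_Ioi
    have hs : 0 < s := hs
    have : ∀ z ∈ Ioi (0 : ℝ),
        ‖z ^ q * (s ^ (a - 1) * exp (-s) * exp (-(1 / (4 * s)) * z ^ 2))‖ =
          s ^ (a - 1) * exp (-s) * (z ^ q * exp (-(1 / (4 * s)) * z ^ 2)) := fun z hz => by
      have hz : 0 < z := hz
      rw [Real.norm_of_nonneg (by positivity)]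
      ring
    simp only
    rw [setIntegral_congr_fun measurableSet_Ioi this, integral_const_mul,
      integral_rpow_mul_exp_neg_inv_mul_sq hq hs, Real.mul_rpow (by positivity) hs.le,
      show a + (q + 1) / 2 - 1 = a - 1 + (q + 1) / 2 by ring, Real.rpow_add hs]
    ring

lemma integrable_prod_matOmega_mul {l α : ℝ} (hl : -1 < l) (hα : 0 < α + l + 1) (r : ℝ) :
    Integrable (Function.uncurry fun z s : ℝ => matOmega l (r * z) * z ^ (2 * l + 1) *
      (s ^ (α - 1) * exp (-s) * exp (-(1 / (4 * s)) * z ^ 2)))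
      ((volume.restrict (Ioi 0)).prod (volume.restrict (Ioi 0))) := by
  obtain ⟨A, B, h⟩ := exists_abs_matOmega_le hl
  have i0 := (integrable_prod_rpow_mul_exp (q := 2 * l + 1) (a := α) (by linarith)
    (by linarith)).const_mul A
  have i1 := (integrable_prod_rpow_mul_exp (q := 2 * l + 1 + 2) (a := α) (by linarith)
    (by linarith)).const_mul (B * r ^ 2)
  have hO := (continuous_matOmega hl).measurable
  have hmeas : Measurable (Function.uncurry fun z s : ℝ => matOmega l (r * z) * z ^ (2 * l + 1) *
      (s ^ (α - 1) * exp (-s) * exp (-(1 / (4 * s)) * z ^ 2))) := by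
    unfold Function.uncurry
    fun_prop
  refine (i0.add i1).mono' hmeas.aestronglyMeasurable ?_
  rw [Measure.prod_restrict]
  refine (ae_restrict_iff' (measurableSet_Ioi.prod measurableSet_Ioi)).2
    (.of_forall fun ⟨z, s⟩ ⟨hz, hs⟩ => ?_)
  have hz : 0 < z := hz
  have hs : 0 < s := hs
  simp only [Function.uncurry, Pi.add_apply]
  rw [mul_assoc, norm_mul, Real.norm_eq_abs, Real.norm_of_nonneg (by positivity),
    Real.rpow_add hz (2 * l + 1) 2, Real.rpow_two]
  calc _ ≤ (A + B * (r * z) ^ 2) * _ := mul_le_mul_of_nonneg_right (h (r * z)) (by positivity)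
    _ = _ := by ring

lemma integral_matOmega_mul_matK {l α : ℝ} (hl : -1 < l) (hα : 0 < α + l + 1) (r : ℝ) :
    ∫ t in Ioi (0 : ℝ), matOmega l (r * t) * matK α t * t ^ (α + 2 * l + 1) =
      2 ^ (α + 2 * l) * Real.Gamma (l + 1) * Real.Gamma (α + l + 1) *
        (1 + r ^ 2) ^ (-α - l - 1) := by
  have hK : ∀ t ∈ Ioi (0 : ℝ), matOmega l (r * t) * matK α t * t ^ (α + 2 * l + 1) =
      2 ^ (α - 1) * ∫ s in Ioi (0 : ℝ), matOmega l (r * t) * t ^ (2 * l + 1) *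
        (s ^ (α - 1) * exp (-s) * exp (-(1 / (4 * s)) * t ^ 2)) := fun t ht => by
    rw [integral_const_mul, mul_left_comm, ← matK_mul_rpow α ht, add_assoc, Real.rpow_add ht]
    ring
  have hW : ∀ s ∈ Ioi (0 : ℝ), ∫ t in Ioi (0 : ℝ), matOmega l (r * t) * t ^ (2 * l + 1) *
        (s ^ (α - 1) * exp (-s) * exp (-(1 / (4 * s)) * t ^ 2)) =
      1 / 2 * Real.Gamma (l + 1) * 4 ^ (l + 1) *
        (s ^ (α + l + 1 - 1) * exp (-((1 + r ^ 2) * s))) := fun s hs => by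
    have hs : 0 < s := hs
    rw [show -((1 + r ^ 2) * s) = -s + -(r ^ 2 * s) by ring, Real.exp_add,
      show α + l + 1 - 1 = α - 1 + (l + 1) by ring, Real.rpow_add hs]
    have := integral_matOmega_mul_exp_neg_inv_mul_sq hl r hs
    rw [Real.mul_rpow (by positivity) hs.le] at this
    calc _ = ∫ t in Ioi (0 : ℝ), (s ^ (α - 1) * exp (-s)) *
          (matOmega l (r * t) * (t ^ (2 * l + 1) * exp (-(1 / (4 * s)) * t ^ 2))) := by
          congr 1
          ext t
          ring
      _ = _ := by
          rw [integral_const_mul, this]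
          ring
  have hr : 0 < 1 + r ^ 2 := by positivity
  rw [setIntegral_congr_fun measurableSet_Ioi hK, integral_const_mul,
    integral_integral_swap (integrable_prod_matOmega_mul hl hα r),
    setIntegral_congr_fun measurableSet_Ioi hW, integral_const_mul,
    Real.integral_rpow_mul_exp_neg_mul_Ioi hα hr, one_div (1 + r ^ 2), Real.inv_rpow hr.le,
    ← Real.rpow_neg hr.le, show -(α + l + 1) = -α - l - 1 by ring]
  have h2 : (2 : ℝ) ^ (α + 2 * l) = 2 ^ (α - 1) * (1 / 2) * 4 ^ (l + 1) := by
    rw [show (4 : ℝ) = 2 ^ (2 : ℝ) by norm_num, ← Real.rpow_mul zero_le_two, one_div,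
      ← Real.rpow_neg_one, ← Real.rpow_add two_pos, ← Real.rpow_add two_pos]
    congr 1
    ring
  rw [h2]
  ring

theorem inverse_multiquadric_hankel_schoenberg (l α : ℝ) (hl : -1 < l)
    (hα : 0 < α + l + 1) (r : ℝ) (hr : 0 ≤ r) :
    (1 + r ^ 2) ^ (-α - l - 1) =
      (1 / ((2 : ℝ) ^ (α + 2 * l) * Real.Gamma (l + 1) * Real.Gamma (α + l + 1))) *
        ∫ t in Ioi (0 : ℝ), matOmega l (r * t) * matK α t * t ^ (α + 2 * l + 1) := by
  have h1 : 0 < Real.Gamma (l + 1) := Real.Gamma_pos_of_pos (by linarith)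
  have h2 : 0 < Real.Gamma (α + l + 1) := Real.Gamma_pos_of_pos hα
  rw [integral_matOmega_mul_matK hl hα r, ← mul_assoc, one_div_mul_cancel (by positivity), one_mul]
end

section
/- Let n be a positive integer, 1 ≤ d ≤ n, and let f : [0, ∞) → [0, ∞) be monotone decreasing with f(0) = 1 and ∫₀^∞ f(t) t^{d−1} dt < ∞. Let X = {x_j : j ∈ ℕ} ⊂ ℝⁿ be a set of distinct points with separation δ = inf_{j ≠ k} |x_j − x_k| > 0 whose linear span has dimension d. Then for every j ∈ ℕ, Σ_{k ∈ ℕ} f(|x_j − x_k|) ≤ 1 + (d(5^d − 1)/δ^d) ∫₀^∞ f(t) t^{d−1} dt. -/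
open MeasureTheory Real Set

/-- Volume bound for the number of `δ`-separated points in a closed ball of radius `R`. -/
theorem card_le_pow_of_separated_of_norm_le {ι E : Type*} [NormedAddCommGroup E] [NormedSpace ℝ E]
    [FiniteDimensional ℝ E] (s : Finset ι) (y : ι → E) {R δ : ℝ} (hR : 0 ≤ R) (hδ : 0 < δ)
    (hs : ∀ i ∈ s, ‖y i‖ ≤ R) (hsep : ∀ i ∈ s, ∀ k ∈ s, i ≠ k → δ ≤ ‖y i - y k‖) :
    (s.card : ℝ) ≤ (2 * (R / δ) + 1) ^ Module.finrank ℝ E := by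
  borelize E
  let μ : Measure E := Measure.addHaar
  have hδ2 : 0 < δ / 2 := half_pos hδ
  have hρ : 0 < R + δ / 2 := by positivity
  have hdisj : (s : Set ι).PairwiseDisjoint fun i => Metric.ball (y i) (δ / 2) := by
    intro i hi k hk hik
    apply Metric.ball_disjoint_ball
    rw [dist_eq_norm]
    linarith [hsep i hi k hk hik]
  have hsub : (⋃ i ∈ s, Metric.ball (y i) (δ / 2)) ⊆ Metric.ball 0 (R + δ / 2) := by
    refine iUnion₂_subset fun i hi => Metric.ball_subset_ball' ?_
    rw [dist_zero_right]
    linarith [hs i hi]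
  have hμ : (s.card : ENNReal) * ENNReal.ofReal ((δ / 2) ^ Module.finrank ℝ E)
      * μ (Metric.ball 0 1) ≤
      ENNReal.ofReal ((R + δ / 2) ^ Module.finrank ℝ E) * μ (Metric.ball 0 1) :=
    calc
      _ = μ (⋃ i ∈ s, Metric.ball (y i) (δ / 2)) := by
        rw [measure_biUnion_finset hdisj fun _ _ => measurableSet_ball]
        simp only [μ.addHaar_ball_of_pos _ hδ2, Finset.sum_const, nsmul_eq_mul, mul_assoc]
      _ ≤ μ (Metric.ball (0 : E) (R + δ / 2)) := measure_mono hsub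
      _ = _ := μ.addHaar_ball_of_pos _ hρ
  have hcard := ENNReal.toReal_le_of_le_ofReal (pow_nonneg hρ.le _)
    ((ENNReal.mul_le_mul_iff_left (Metric.measure_ball_pos _ _ zero_lt_one).ne'
      measure_ball_lt_top.ne).1 hμ)
  rw [ENNReal.toReal_mul, ENNReal.toReal_natCast, ENNReal.toReal_ofReal (by positivity),
    ← le_div_iff₀ (by positivity), ← div_pow] at hcard
  convert! hcard using 2
  field_simp

/-- If at most `A * r ^ (m + 1)` of the radii are at most `r`, for every radius `r`, then the sum of
a decreasing function over the radii is bounded by an integral. -/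
theorem sum_le_integral_of_card_le {ι : Type*} {f : ℝ → ℝ} {m : ℕ} {A : ℝ} (hA : 0 < A)
    (hf_nonneg : ∀ t, 0 ≤ t → 0 ≤ f t) (hf_mono : AntitoneOn f (Ici 0))
    (hf_int : IntegrableOn (fun t => f t * t ^ m) (Ioi 0))
    (r : ι → ℝ) (hr : ∀ i, 0 ≤ r i) (s : Finset ι)
    (hs : ∀ i ∈ s, ((s.filter fun k => r k ≤ r i).card : ℝ) ≤ A * r i ^ (m + 1)) :
    ∑ i ∈ s, f (r i) ≤ A * (m + 1) * ∫ t in Ioi 0, f t * t ^ m := by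
  classical
  let a : ℕ → ℝ := fun i => ((i : ℝ) / A) ^ (((m + 1 : ℕ) : ℝ)⁻¹)
  have ha0 (i : ℕ) : 0 ≤ a i := by positivity
  have ha_pow (i : ℕ) : a i ^ (m + 1) = i / A :=
    rpow_inv_natCast_pow (by positivity) (Nat.succ_ne_zero m)
  have hint {u v : ℝ} (hu : 0 ≤ u) (huv : u ≤ v) :
      IntervalIntegrable (fun t => f t * t ^ m) volume u v :=
    (intervalIntegrable_iff_integrableOn_Ioc_of_le huv).2
      (hf_int.mono_set fun _ ht => lt_of_le_of_lt hu ht.1)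
  have key : (∀ i ∈ s, ((s.filter fun k => r k ≤ r i).card : ℝ) ≤ A * r i ^ (m + 1)) →
      ∑ i ∈ s, f (r i) ≤ A * (m + 1) * ∫ t in (0 : ℝ)..a s.card, f t * t ^ m := by
    clear hs
    induction s using Finset.induction_on_max_value r with
    | empty =>
      have ha_zero : a 0 = 0 := pow_eq_zero_iff (Nat.succ_ne_zero m) |>.1 (by simp [ha_pow])
      simp [ha_zero]
    | insert b s hb hmax ih =>
      intro h
      have hs : ∑ i ∈ s, f (r i) ≤ A * (m + 1) * ∫ t in (0 : ℝ)..a s.card, f t * t ^ m := by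
        refine ih fun i hi => le_trans ?_ (h i (Finset.mem_insert_of_mem hi))
        exact_mod_cast Finset.card_le_card
          (Finset.filter_subset_filter _ (Finset.subset_insert b s))
      have hcard : ((s.card + 1 : ℕ) : ℝ) ≤ A * r b ^ (m + 1) := by
        have := h b (Finset.mem_insert_self b s)
        rwa [Finset.filter_true_of_mem, Finset.card_insert_of_notMem hb] at this
        intro k hk
        rcases Finset.mem_insert.1 hk with rfl | hk
        exacts [le_rfl, hmax k hk]
      have har : a (s.card + 1) ≤ r b := by
        refine le_of_pow_le_pow_left₀ (Nat.succ_ne_zero m) (hr b) ?_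
        rwa [ha_pow, div_le_iff₀' hA]
      have haa : a s.card ≤ a (s.card + 1) := by
        refine rpow_le_rpow (by positivity) ?_ (by positivity)
        gcongr
        simp
      have hstep : f (r b) ≤
          A * (m + 1) * ∫ t in a s.card..a (s.card + 1), f t * t ^ m := by
        have hlow : ∫ t in a s.card..a (s.card + 1), f (a (s.card + 1)) * t ^ m ≤
            ∫ t in a s.card..a (s.card + 1), f t * t ^ m := by
          refine intervalIntegral.integral_mono_on haa
            (Continuous.intervalIntegrable (by fun_prop) _ _) (hint (ha0 _) haa) fun t ht => ?_
          have ht0 : 0 ≤ t := (ha0 _).trans ht.1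
          exact mul_le_mul_of_nonneg_right (hf_mono ht0 (ha0 _) ht.2) (by positivity)
        rw [intervalIntegral.integral_const_mul, integral_pow, ha_pow, ha_pow] at hlow
        calc f (r b) ≤ f (a (s.card + 1)) := hf_mono (ha0 _) (hr b) har
          _ = A * (m + 1) * (f (a (s.card + 1)) *
              ((((s.card + 1 : ℕ) : ℝ) / A - s.card / A) / (m + 1))) := by
            push_cast
            field_simp
            ring
          _ ≤ _ := mul_le_mul_of_nonneg_left hlow (by positivity)
      rw [Finset.sum_insert hb, Finset.card_insert_of_notMem hb,
        ← intervalIntegral.integral_add_adjacent_intervals (hint le_rfl (ha0 _))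
          (hint (ha0 _) haa), mul_add]
      linarith
  refine (key hs).trans (mul_le_mul_of_nonneg_left ?_ (by positivity))
  rw [intervalIntegral.integral_of_le (ha0 _)]
  refine setIntegral_mono_set hf_int ?_ Ioc_subset_Ioi_self.eventuallyLE
  filter_upwards [ae_restrict_mem measurableSet_Ioi] with t ht
  exact mul_nonneg (hf_nonneg t (le_of_lt ht)) (pow_nonneg (le_of_lt ht) m)

theorem schoenberg_row_sum_bound (n d : ℕ) (hn : 0 < n) (hd1 : 1 ≤ d) (hdn : d ≤ n)
    (f : ℝ → ℝ) (hf_nonneg : ∀ t : ℝ, 0 ≤ t → 0 ≤ f t)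
    (hf_mono : AntitoneOn f (Ici 0)) (hf0 : f 0 = 1)
    (hf_int : IntegrableOn (fun t : ℝ => f t * t ^ ((d : ℝ) - 1)) (Ioi 0))
    (x : ℕ → EuclideanSpace ℝ (Fin n)) (δ : ℝ) (hδ : 0 < δ)
    (hsep : ∀ j k : ℕ, j ≠ k → δ ≤ ‖x j - x k‖)
    (hspan : Module.finrank ℝ (Submodule.span ℝ (Set.range x)) = d)
    (j : ℕ) :
    (∑' k : ℕ, f ‖x j - x k‖) ≤
      1 + ((d : ℝ) * ((5 : ℝ) ^ d - 1) / δ ^ d) *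
        ∫ t in Ioi (0 : ℝ), f t * t ^ ((d : ℝ) - 1) := by
  classical
  obtain ⟨m, rfl⟩ : ∃ m, d = m + 1 := ⟨d - 1, by omega⟩
  have hexp : (((m + 1 : ℕ) : ℝ) - 1) = (m : ℝ) := by push_cast; ring
  simp only [hexp, rpow_natCast] at hf_int ⊢
  have h35 : (3 : ℝ) ^ (m + 1) + 1 ≤ 5 ^ (m + 1) := by
    have h1 : (1 : ℝ) ≤ 5 ^ m := one_le_pow₀ (by norm_num)
    have h2 : (3 : ℝ) ^ m ≤ 5 ^ m := by gcongr; norm_num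
    rw [pow_succ, pow_succ]
    linarith
  have hA : 0 < ((5 : ℝ) ^ (m + 1) - 1) / δ ^ (m + 1) := by
    have : (0 : ℝ) < 3 ^ (m + 1) := by positivity
    exact div_pos (by linarith) (by positivity)
  let y : ℕ → Submodule.span ℝ (Set.range x) := fun k =>
    ⟨x j - x k, sub_mem (Submodule.subset_span ⟨j, rfl⟩) (Submodule.subset_span ⟨k, rfl⟩)⟩
  have hysep (i k : ℕ) (hik : i ≠ k) : δ ≤ ‖y i - y k‖ := by
    have : ‖y i - y k‖ = ‖x k - x i‖ := by
      change ‖(x j - x i) - (x j - x k)‖ = _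
      rw [sub_sub_sub_cancel_left]
    rw [this]
    exact hsep k i hik.symm
  have hcount (s : Finset ℕ) (hjs : j ∉ s) (i : ℕ) (hi : i ∈ s) :
      ((s.filter fun k => ‖x j - x k‖ ≤ ‖x j - x i‖).card : ℝ) ≤
        (5 ^ (m + 1) - 1) / δ ^ (m + 1) * ‖x j - x i‖ ^ (m + 1) := by
    have hij : j ≠ i := fun h => hjs (h ▸ hi)
    have hu : 1 ≤ ‖x j - x i‖ / δ := (one_le_div hδ).2 (hsep j i hij)
    have hball := card_le_pow_of_separated_of_norm_le
      (insert j (s.filter fun k => ‖x j - x k‖ ≤ ‖x j - x i‖)) y (norm_nonneg (x j - x i)) hδ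
      (by
        intro k hk
        change ‖x j - x k‖ ≤ _
        rcases Finset.mem_insert.1 hk with rfl | hk
        · simp
        · exact (Finset.mem_filter.1 hk).2)
      (fun i _ k _ hik => hysep i k hik)
    rw [Finset.card_insert_of_notMem (by simp [hjs]), hspan] at hball
    push_cast at hball
    rw [div_mul_eq_mul_div, mul_div_assoc, ← div_pow]
    set u := ‖x j - x i‖ / δ
    have h3 : (2 * u + 1) ^ (m + 1) ≤ 3 ^ (m + 1) * u ^ (m + 1) := by
      rw [← mul_pow]
      gcongr
      linarith
    have h5 := mul_le_mul_of_nonneg_right h35 (pow_nonneg (zero_le_one.trans hu) (m + 1))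
    linarith [one_le_pow₀ hu (n := m + 1)]
  refine Real.tsum_le_of_sum_le (fun k => hf_nonneg _ (norm_nonneg _)) fun s => ?_
  have hbound := sum_le_integral_of_card_le hA hf_nonneg hf_mono hf_int (fun k => ‖x j - x k‖)
    (fun k => norm_nonneg _) (s.erase j) (hcount _ (Finset.notMem_erase j s))
  calc ∑ k ∈ s, f ‖x j - x k‖ ≤ ∑ k ∈ insert j (s.erase j), f ‖x j - x k‖ := by
        refine Finset.sum_le_sum_of_subset_of_nonneg (Finset.insert_erase_subset j s)
          fun k _ _ => hf_nonneg _ (norm_nonneg _)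
    _ = 1 + ∑ k ∈ s.erase j, f ‖x j - x k‖ := by
        rw [Finset.sum_insert (Finset.notMem_erase j s), sub_self, norm_zero, hf0]
    _ ≤ _ := by
        refine add_le_add_right (hbound.trans_eq ?_) 1
        push_cast
        ring
end

section
/- Let n be a positive integer, 1 ≤ d ≤ n, and let f : [0, ∞) → [0, ∞) be monotone decreasing with f(0) = 1 and ∫₀^∞ f(t) t^{d−1} dt < ∞. Let X = {x_j : j ∈ ℕ} ⊂ ℝⁿ be a set of distinct points with separation δ = inf_{j ≠ k} |x_j − x_k| > 0 whose linear span has dimension d, and suppose in addition that δ^d > d(5^d − 1) ∫₀^∞ f(t) t^{d−1} dt. Then with θ = (d(5^d − 1)/δ^d) ∫₀^∞ f(t) t^{d−1} dt < 1, for every square-summable complex sequence (a_j) the quadratic form satisfies Re( Σ_{j,k ∈ ℕ} f(|x_j − x_k|) a_j conj(a_k) ) ≥ (1 − θ) Σ_{j ∈ ℕ} |a_j|². -/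
open MeasureTheory Real Set

/-- Volume bound for packings: `δ`-separated points inside a closed ball of radius `r`. -/
lemma card_mul_pow_le_of_separated {V ι : Type*} [NormedAddCommGroup V] [NormedSpace ℝ V]
    [FiniteDimensional ℝ V] (T : Finset ι) (y : ι → V) (c : V) {δ r : ℝ} (hδ : 0 < δ)
    (hr : 0 ≤ r) (hsep : ∀ i ∈ T, ∀ k ∈ T, i ≠ k → δ ≤ ‖y i - y k‖)
    (hball : ∀ i ∈ T, ‖y i - c‖ ≤ r) :
    (T.card : ℝ) * (δ / 2) ^ Module.finrank ℝ V ≤ (r + δ / 2) ^ Module.finrank ℝ V := by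
  borelize V
  set μ : Measure V := Measure.addHaar
  have hdisj : (T : Set ι).PairwiseDisjoint fun i => Metric.ball (y i) (δ / 2) := by
    intro i hi k hk hik
    refine Metric.ball_disjoint_ball ?_
    rw [dist_eq_norm]
    linarith [hsep i hi k hk hik]
  have hsub : (⋃ i ∈ T, Metric.ball (y i) (δ / 2)) ⊆ Metric.ball c (r + δ / 2) := by
    refine iUnion₂_subset fun i hi => Metric.ball_subset_ball' ?_
    rw [dist_eq_norm]
    linarith [hball i hi]
  have hle := measure_mono (μ := μ) hsub
  rw [measure_biUnion_finset hdisj fun _ _ => measurableSet_ball] at hle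
  simp only [Measure.addHaar_ball_of_pos μ _ (half_pos hδ),
    Measure.addHaar_ball_of_pos μ c (show 0 < r + δ / 2 by positivity), Finset.sum_const,
    nsmul_eq_mul, ← mul_assoc] at hle
  rw [ENNReal.mul_le_mul_iff_left (Metric.measure_ball_pos μ _ one_pos).ne'
    measure_ball_lt_top.ne, ← ENNReal.ofReal_natCast, ← ENNReal.ofReal_mul (by positivity)] at hle
  exact (ENNReal.ofReal_le_ofReal_iff (by positivity)).1 hle

/-- The number of `δ`-separated points other than the centre in a ball of radius `r ≥ δ`. -/
lemma card_le_of_separated_punctured {V ι : Type*} [NormedAddCommGroup V] [NormedSpace ℝ V]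
    [FiniteDimensional ℝ V] (hV : Module.finrank ℝ V ≠ 0) (T : Finset ι) (y : ι → V) (j : ι)
    (hj : j ∉ T) {δ r : ℝ} (hδ : 0 < δ) (hr : δ ≤ r)
    (hsep : ∀ i k, i ≠ k → δ ≤ ‖y i - y k‖) (hball : ∀ i ∈ T, ‖y i - y j‖ ≤ r) :
    (T.card : ℝ) ≤
      (5 ^ Module.finrank ℝ V - 1) / δ ^ Module.finrank ℝ V * r ^ Module.finrank ℝ V := by
  classical
  have hr0 : 0 ≤ r := hδ.le.trans hr
  have h := card_mul_pow_le_of_separated (insert j T) y (y j) hδ hr0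
    (fun i _ k _ => hsep i k) (fun i hi => by
      rcases Finset.mem_insert.1 hi with rfl | hi
      · simpa using hr0
      · exact hball i hi)
  rw [Finset.card_insert_of_notMem hj] at h
  set d := Module.finrank ℝ V
  have h1 : (r + δ / 2) ^ d ≤ (3 * (r / 2)) ^ d :=
    pow_le_pow_left₀ (by positivity) (by linarith) d
  have h2 : (3 : ℝ) ^ d + 1 ≤ 5 ^ d := by
    have : 3 ^ d < 5 ^ d := Nat.pow_lt_pow_left (by norm_num) hV
    exact_mod_cast this
  rw [mul_pow, div_pow] at h1
  rw [div_pow] at h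
  have h3 : ((T.card + 1 : ℕ) : ℝ) * δ ^ d ≤ 3 ^ d * r ^ d := by
    have := h.trans h1
    rwa [mul_div_assoc', mul_div_assoc', div_le_div_iff_of_pos_right (by positivity)] at this
  have h4 : 3 ^ d * r ^ d ≤ (5 ^ d - 1) * r ^ d :=
    mul_le_mul_of_nonneg_right (by linarith) (by positivity)
  rw [div_mul_eq_mul_div, le_div_iff₀ (by positivity)]
  push_cast at h3
  nlinarith [pow_pos hδ d]

/-- On `[a, b]`, an antitone weight is at least its value at `b`. -/
lemma mul_pow_sub_pow_le_intervalIntegral {f : ℝ → ℝ} {m : ℕ} (hf : AntitoneOn f (Ici 0))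
    (hint : IntegrableOn (fun t => f t * t ^ m) (Ioi 0)) {a b : ℝ} (ha : 0 ≤ a) (hab : a ≤ b) :
    f b * (b ^ (m + 1) - a ^ (m + 1)) ≤ (m + 1) * ∫ t in a..b, f t * t ^ m := by
  have hle : ∫ t in a..b, f b * t ^ m ≤ ∫ t in a..b, f t * t ^ m := by
    refine intervalIntegral.integral_mono_on hab ((by fun_prop : Continuous _).intervalIntegrable _ _) ?_ ?_
    · rw [intervalIntegrable_iff_integrableOn_Ioc_of_le hab]
      exact hint.mono_set fun t ht => ha.trans_lt ht.1
    · intro t ht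
      have ht0 : 0 ≤ t := ha.trans ht.1
      have := hf ht0 (ha.trans hab) ht.2
      gcongr
  rw [intervalIntegral.integral_const_mul, integral_pow, mul_div_assoc',
    div_le_iff₀ (by positivity)] at hle
  linarith

/-- Rearrangement bound: radii whose counting function is at most `C r ^ (m + 1)`. -/
lemma sum_antitone_le_intervalIntegral {ι : Type*} {f : ℝ → ℝ} {m : ℕ} {C : ℝ} (hC : 0 < C)
    (hf : AntitoneOn f (Ici 0)) (hint : IntegrableOn (fun t => f t * t ^ m) (Ioi 0))
    (ρ : ι → ℝ) (hρ : ∀ i, 0 ≤ ρ i) (S : Finset ι)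
    (hcount : ∀ T ⊆ S, ∀ i ∈ T, (∀ k ∈ T, ρ k ≤ ρ i) → (T.card : ℝ) ≤ C * ρ i ^ (m + 1)) :
    ∑ i ∈ S, f (ρ i) ≤ C * (m + 1) *
      ∫ t in 0..(((S.card : ℝ) / C) ^ (((m + 1 : ℕ) : ℝ)⁻¹)), f t * t ^ m := by
  classical
  induction S using Finset.induction_on_max_value ρ with
  | empty => simp [Real.zero_rpow (show ((m : ℝ) + 1)⁻¹ ≠ 0 by positivity)]
  | insert a s has hmax ih =>
    have ih := ih fun T hT => hcount T (hT.trans (Finset.subset_insert a s))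
    have hN := hcount _ subset_rfl a (Finset.mem_insert_self a s) (by simpa using hmax)
    rw [Finset.card_insert_of_notMem has] at hN ⊢
    rw [Finset.sum_insert has]
    set u := ((s.card : ℝ) / C) ^ (((m + 1 : ℕ) : ℝ)⁻¹)
    set v := (((s.card + 1 : ℕ) : ℝ) / C) ^ (((m + 1 : ℕ) : ℝ)⁻¹)
    have hu : 0 ≤ u := by positivity
    have huv : u ≤ v := by
      refine Real.rpow_le_rpow (by positivity) ?_ (by positivity)
      gcongr
      simp
    have hup : u ^ (m + 1) = s.card / C := Real.rpow_inv_natCast_pow (by positivity) (by simp)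
    have hvp : v ^ (m + 1) = (s.card + 1 : ℕ) / C :=
      Real.rpow_inv_natCast_pow (by positivity) (by simp)
    have hva : v ≤ ρ a := by
      refine le_of_pow_le_pow_left₀ (Nat.succ_ne_zero m) (hρ a) ?_
      rw [Nat.succ_eq_add_one, hvp, div_le_iff₀' hC]
      exact hN
    have hii : ∀ {p q : ℝ}, 0 ≤ p → p ≤ q →
        IntervalIntegrable (fun t => f t * t ^ m) volume p q := by
      intro p q hp hpq
      rw [intervalIntegrable_iff_integrableOn_Ioc_of_le hpq]
      exact hint.mono_set fun t ht => hp.trans_lt ht.1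
    rw [← intervalIntegral.integral_add_adjacent_intervals (hii le_rfl hu) (hii hu huv), mul_add]
    have hstep := mul_pow_sub_pow_le_intervalIntegral hf hint hu huv
    rw [hup, hvp, ← sub_div, Nat.cast_add_one, add_sub_cancel_left, mul_one_div,
      div_le_iff₀' hC] at hstep
    have hfa : f (ρ a) ≤ f v := hf (hu.trans huv) (hρ a) hva
    linarith

/-- Schur test for a perturbation of the identity, as a lower bound for the quadratic form. -/
lemma re_tsum_quadratic_form_ge {ι : Type*} [DecidableEq ι] (K : ι → ι → ℝ) (θ : ℝ)
    (hK : ∀ j k, 0 ≤ K j k) (hsymm : ∀ j k, K j k = K k j) (hdiag : ∀ j, K j j = 1)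
    (hrow : ∀ j, ∀ S : Finset ι, j ∉ S → ∑ k ∈ S, K j k ≤ θ)
    (a : ι → ℂ) (ha : Summable fun j => ‖a j‖ ^ 2) :
    (1 - θ) * ∑' j, ‖a j‖ ^ 2 ≤
      (∑' j, ∑' k, (K j k : ℂ) * a j * (starRingEnd ℂ) (a k)).re := by
  have hrow' : ∀ j, ∀ S : Finset ι, ∑ k ∈ S, K j k ≤ 1 + θ := fun j S => by
    have h1 : ∑ k ∈ S, K j k ≤ ∑ k ∈ insert j (S.erase j), K j k :=
      Finset.sum_le_sum_of_subset_of_nonneg (by grind) fun k _ _ => hK j k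
    rw [Finset.sum_insert (by simp), hdiag] at h1
    linarith [hrow j (S.erase j) (by simp)]
  have hsK : ∀ j, Summable (K j) := fun j => summable_of_sum_le (hK j) (hrow' j)
  have htK : ∀ j, ∑' k, K j k ≤ 1 + θ := fun j => (hsK j).tsum_le_of_sum_le (hrow' j)
  have hsec : ∀ j, Summable fun k => K j k * ‖a j‖ ^ 2 := fun j =>
    (hsK j).mul_right (‖a j‖ ^ 2)
  have htsec : ∀ j, ∑' k, K j k * ‖a j‖ ^ 2 ≤ (1 + θ) * ‖a j‖ ^ 2 := fun j => by
    rw [tsum_mul_right]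
    exact mul_le_mul_of_nonneg_right (htK j) (by positivity)
  have hnn : ∀ j k, 0 ≤ K j k * ‖a j‖ ^ 2 := fun j k => mul_nonneg (hK j k) (by positivity)
  have hsP : Summable fun p : ι × ι => K p.1 p.2 * ‖a p.1‖ ^ 2 :=
    (summable_prod_of_nonneg fun p : ι × ι => hnn p.1 p.2).2 ⟨hsec,
      Summable.of_nonneg_of_le (fun j => tsum_nonneg (hnn j)) htsec (ha.mul_left (1 + θ))⟩
  have htP : ∑' p : ι × ι, K p.1 p.2 * ‖a p.1‖ ^ 2 ≤ (1 + θ) * ∑' j, ‖a j‖ ^ 2 := by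
    rw [hsP.tsum_prod, ← tsum_mul_left]
    exact hsP.prod.tsum_le_tsum htsec (ha.mul_left (1 + θ))
  have hswap : (fun p : ι × ι => K p.1 p.2 * ‖a p.2‖ ^ 2) =
      (fun p : ι × ι => K p.1 p.2 * ‖a p.1‖ ^ 2) ∘ Equiv.prodComm ι ι := by
    ext p
    simp [hsymm p.1 p.2]
  have hsQ : Summable fun p : ι × ι => K p.1 p.2 * ‖a p.2‖ ^ 2 := by
    rw [hswap]
    exact (Equiv.summable_iff _).2 hsP
  have htQ : ∑' p : ι × ι, K p.1 p.2 * ‖a p.2‖ ^ 2 = ∑' p : ι × ι, K p.1 p.2 * ‖a p.1‖ ^ 2 := by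
    rw [hswap]
    exact (Equiv.prodComm ι ι).tsum_eq fun p : ι × ι => K p.1 p.2 * ‖a p.1‖ ^ 2
  let F : ι × ι → ℂ := fun p => (K p.1 p.2 : ℂ) * a p.1 * (starRingEnd ℂ) (a p.2)
  have hnorm : ∀ p, ‖F p‖ ≤ (K p.1 p.2 * ‖a p.1‖ ^ 2 + K p.1 p.2 * ‖a p.2‖ ^ 2) / 2 := fun p => by
    simp only [F, norm_mul, Complex.norm_real, RCLike.norm_conj, Real.norm_of_nonneg (hK _ _)]
    nlinarith [mul_nonneg (hK p.1 p.2) (sq_nonneg (‖a p.1‖ - ‖a p.2‖))]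
  have hsF : Summable F := .of_norm_bounded ((hsP.add hsQ).div_const 2) hnorm
  have hinj : Function.Injective fun j : ι => (j, j) := fun i j h => congrArg Prod.fst h
  let D : ι × ι → ℝ := Function.extend (fun j : ι => (j, j)) (fun j => 2 * ‖a j‖ ^ 2) 0
  have hD : HasSum D (2 * ∑' j, ‖a j‖ ^ 2) :=
    (hasSum_extend_zero hinj).2 (ha.hasSum.mul_left 2)
  have hpt : ∀ p, D p ≤ (F p).re +
      (K p.1 p.2 * ‖a p.1‖ ^ 2 + K p.1 p.2 * ‖a p.2‖ ^ 2) / 2 := by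
    rintro ⟨j, k⟩
    by_cases hjk : j = k
    · subst hjk
      have h1 : D (j, j) = 2 * ‖a j‖ ^ 2 := hinj.extend_apply _ _ j
      have h2 : (F (j, j)).re = ‖a j‖ ^ 2 := by
        simp only [F, hdiag, Complex.ofReal_one, one_mul, Complex.mul_conj]
        rw [Complex.ofReal_re, Complex.normSq_eq_norm_sq]
      rw [h1, h2]
      simp only [hdiag]
      linarith
    · have h1 : D (j, k) = 0 := Function.extend_apply' _ _ _ (by grind)
      rw [h1]
      linarith [hnorm (j, k), (abs_le.1 (Complex.abs_re_le_norm (F (j, k)))).1]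
  have hsum := ((Complex.hasSum_re hsF.hasSum).add ((hsP.add hsQ).div_const 2).hasSum)
  have hle := hasSum_le hpt hD hsum
  rw [tsum_div_const, hsP.tsum_add hsQ, htQ, hsF.tsum_prod] at hle
  linarith

open MeasureTheory Real Set

theorem schoenberg_quadratic_form_lower_bound (n d : ℕ) (hn : 0 < n) (hd1 : 1 ≤ d) (hdn : d ≤ n)
    (f : ℝ → ℝ) (hf_nonneg : ∀ t : ℝ, 0 ≤ t → 0 ≤ f t)
    (hf_mono : AntitoneOn f (Ici 0)) (hf0 : f 0 = 1)
    (hf_int : IntegrableOn (fun t : ℝ => f t * t ^ ((d : ℝ) - 1)) (Ioi 0))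
    (x : ℕ → EuclideanSpace ℝ (Fin n)) (δ : ℝ) (hδ : 0 < δ)
    (hsep : ∀ j k : ℕ, j ≠ k → δ ≤ ‖x j - x k‖)
    (hspan : Module.finrank ℝ (Submodule.span ℝ (Set.range x)) = d)
    (hsmall : (d : ℝ) * ((5 : ℝ) ^ d - 1) * (∫ t in Ioi (0 : ℝ), f t * t ^ ((d : ℝ) - 1)) < δ ^ d)
    (θ : ℝ)
    (hθ : θ = ((d : ℝ) * ((5 : ℝ) ^ d - 1) / δ ^ d) *
      ∫ t in Ioi (0 : ℝ), f t * t ^ ((d : ℝ) - 1)) :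
    θ < 1 ∧
      ∀ a : ℕ → ℂ, Summable (fun j : ℕ => ‖a j‖ ^ 2) →
        (1 - θ) * (∑' j : ℕ, ‖a j‖ ^ 2) ≤
          (∑' j : ℕ, ∑' k : ℕ,
            ((f ‖x j - x k‖ : ℝ) : ℂ) * a j * (starRingEnd ℂ) (a k)).re := by
  obtain ⟨m, rfl⟩ : ∃ m, d = m + 1 := ⟨d - 1, by omega⟩
  have hpow : ∀ t : ℝ, f t * t ^ (((m + 1 : ℕ) : ℝ) - 1) = f t * t ^ m := fun t => by
    rw [Nat.cast_add_one, add_sub_cancel_right, Real.rpow_natCast]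
  simp only [hpow] at hf_int hsmall hθ
  set I := ∫ t in Ioi (0 : ℝ), f t * t ^ m
  refine ⟨?_, fun a ha => ?_⟩
  · rwa [hθ, div_mul_eq_mul_div, div_lt_one (by positivity)]
  set V := Submodule.span ℝ (Set.range x)
  let y : ℕ → V := fun j => ⟨x j, Submodule.subset_span ⟨j, rfl⟩⟩
  have hC : 0 < ((5 : ℝ) ^ (m + 1) - 1) / δ ^ (m + 1) :=
    div_pos (sub_pos.2 (one_lt_pow₀ (by norm_num) m.succ_ne_zero)) (by positivity)
  refine re_tsum_quadratic_form_ge (fun j k => f ‖x j - x k‖) θ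
    (fun j k => hf_nonneg _ (norm_nonneg _)) (fun j k => by rw [norm_sub_rev])
    (fun j => by simpa using hf0) (fun j S hjS => ?_) a ha
  refine (sum_antitone_le_intervalIntegral hC hf_mono hf_int (fun k => ‖x j - x k‖)
    (fun k => norm_nonneg _) S fun T hT i hi hmax => ?_).trans ?_
  · have hjT : j ∉ T := fun h => hjS (hT h)
    have := card_le_of_separated_punctured (V := V) (by simp [hspan]) T y j hjT hδ
      (hsep j i fun h => hjT (h ▸ hi)) (fun i k => hsep i k)
      (fun k hk => (norm_sub_rev (y k) (y j)).trans_le (hmax k hk))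
    rwa [hspan] at this
  · have hle : ∫ t in 0..(((S.card : ℝ) / ((5 ^ (m + 1) - 1) / δ ^ (m + 1))) ^
        (((m + 1 : ℕ) : ℝ)⁻¹)), f t * t ^ m ≤ I := by
      rw [intervalIntegral.integral_of_le (by positivity)]
      refine setIntegral_mono_set hf_int ?_ (Ioc_subset_Ioi_self.eventuallyLE)
      filter_upwards [ae_restrict_mem measurableSet_Ioi] with t ht
      have ht0 : 0 ≤ t := le_of_lt ht
      exact mul_nonneg (hf_nonneg t ht0) (by positivity)
    refine (mul_le_mul_of_nonneg_left hle (by positivity)).trans_eq ?_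
    rw [hθ]
    push_cast
    ring
end

section
/- Let α > 0 and let X = {x_j : j ∈ ℕ} ⊂ ℝ be a set of distinct real numbers with separation δ = inf_{j ≠ k} |x_j − x_k| satisfying δ > 4 Γ(α + 1/2) Γ(1/2) / Γ(α). Then with θ = 4 Γ(α + 1/2) Γ(1/2) / (δ Γ(α)) < 1, for every square-summable complex sequence (a_j) one has Re( Σ_{j,k ∈ ℕ} 𝓜_α(|x_j − x_k|) a_j conj(a_k) ) ≥ (1 − θ) Σ_{j ∈ ℕ} |a_j|²; in particular the Schoenberg matrix [𝓜_α(|x_j − x_k|)]_{j,k} defines a bounded invertible operator on ℓ²(ℕ). -/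
open MeasureTheory Real Set

theorem matern_eq_integral_Ioi (a : ℝ) {z : ℝ} (hz : 0 < z) :
    matern a z = (Real.Gamma a)⁻¹ *
      ∫ s in Ioi (0 : ℝ), Real.exp (-s) * s ^ (a - 1) * Real.exp (-(1 / (4 * s)) * z ^ 2) := by
  have hinj : InjOn (fun t : ℝ => z / 2 * Real.exp (-t)) univ := by
    intro s _ t _ h
    have h' : Real.exp (-s) = Real.exp (-t) := mul_left_cancel₀ (by positivity) h
    simpa using h'
  have himage : (fun t : ℝ => z / 2 * Real.exp (-t)) '' univ = Ioi 0 := by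
    ext s
    simp only [image_univ, mem_range, mem_Ioi]
    constructor
    · rintro ⟨t, rfl⟩
      positivity
    · intro hs
      refine ⟨-Real.log (2 * s / z), ?_⟩
      rw [neg_neg, Real.exp_log (by positivity)]
      field_simp
  have hderiv : ∀ t ∈ (univ : Set ℝ), HasDerivWithinAt (fun t : ℝ => z / 2 * Real.exp (-t))
      (-(z / 2 * Real.exp (-t))) univ t := by
    intro t _
    have h := ((hasDerivAt_neg t).exp.const_mul (z / 2)).hasDerivWithinAt (s := univ)
    rwa [mul_neg_one, mul_neg] at h
  have hpt : ∀ t : ℝ, |-(z / 2 * Real.exp (-t))| • (Real.exp (-(z / 2 * Real.exp (-t))) *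
      (z / 2 * Real.exp (-t)) ^ (a - 1) *
        Real.exp (-(1 / (4 * (z / 2 * Real.exp (-t)))) * z ^ 2)) =
      (z / 2) ^ a * Real.exp (-z * Real.cosh t - a * t) := by
    intro t
    have hpos : 0 < z / 2 * Real.exp (-t) := by positivity
    rw [abs_neg, abs_of_pos hpos, smul_eq_mul, Real.rpow_sub_one hpos.ne',
      Real.mul_rpow (by positivity) (Real.exp_pos _).le, ← Real.exp_mul]
    have hexp : -(1 / (4 * (z / 2 * Real.exp (-t)))) * z ^ 2 = -(z / 2 * Real.exp t) := by
      rw [Real.exp_neg]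
      field_simp
      ring
    rw [hexp, Real.cosh_eq]
    have hsplit : Real.exp (-z * ((Real.exp t + Real.exp (-t)) / 2) - a * t) =
        Real.exp (-(z / 2 * Real.exp (-t))) * Real.exp (-(z / 2 * Real.exp t)) *
          Real.exp (-t * a) := by
      rw [← Real.exp_add, ← Real.exp_add]
      congr 1
      ring
    rw [hsplit]
    field_simp
  have hint := integral_image_eq_integral_abs_deriv_smul MeasurableSet.univ hderiv hinj
    (fun s : ℝ => Real.exp (-s) * s ^ (a - 1) * Real.exp (-(1 / (4 * s)) * z ^ 2))
  rw [himage] at hint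
  rw [hint, setIntegral_univ]
  simp only [hpt]
  rw [integral_const_mul, matern, if_neg hz.ne', matK, Real.div_rpow hz.le (by norm_num),
    Real.rpow_sub (by norm_num), Real.rpow_one]
  ring

theorem integrableOn_exp_mul_rpow_mul_gaussian {a : ℝ} (ha : 0 < a) (z : ℝ) :
    IntegrableOn (fun s : ℝ => Real.exp (-s) * s ^ (a - 1) *
      Real.exp (-(1 / (4 * s)) * z ^ 2)) (Ioi 0) := by
  refine (Real.GammaIntegral_convergent ha).mono' (by fun_prop) ?_
  filter_upwards [ae_restrict_mem measurableSet_Ioi] with s hs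
  have hs' : (0 : ℝ) < s := hs
  rw [Real.norm_of_nonneg (by positivity)]
  refine mul_le_of_le_one_right (by positivity) (Real.exp_le_one_iff.2 ?_)
  have : 0 ≤ 1 / (4 * s) * z ^ 2 := by positivity
  linarith

theorem sum_gaussian_le_of_separated {ι : Type*} (F : Finset ι) (y : ι → ℝ) {δ b : ℝ}
    (hδ : 0 < δ) (hb : 0 < b) (hy : ∀ k ∈ F, δ ≤ |y k|)
    (hsep : ∀ k ∈ F, ∀ l ∈ F, k ≠ l → δ ≤ |y k - y l|) :
    ∑ k ∈ F, Real.exp (-b * y k ^ 2) ≤ 2 / δ * √(π / b) := by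
  classical
  set c : ι → ℝ := fun k => if 0 < y k then y k - δ / 2 else y k
  have hc : ∀ k ∈ F, ∀ t ∈ Ioo (c k) (c k + δ / 2), |t - y k| < δ / 2 ∧ |t| ≤ |y k| := by
    intro k hk t ht
    have hk' := hy k hk
    obtain ⟨h1, h2⟩ := ht
    simp only [c] at h1 h2
    split_ifs at h1 h2 with h
    · rw [abs_of_pos h] at hk' ⊢
      exact ⟨abs_lt.2 ⟨by linarith, by linarith⟩, abs_le.2 ⟨by linarith, by linarith⟩⟩
    · push Not at h
      rw [abs_of_nonpos h] at hk' ⊢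
      exact ⟨abs_lt.2 ⟨by linarith, by linarith⟩, abs_le.2 ⟨by linarith, by linarith⟩⟩
  have hint : Integrable (fun t : ℝ => Real.exp (-b * t ^ 2)) := integrable_exp_neg_mul_sq hb
  have hlower : ∀ k ∈ F, δ / 2 * Real.exp (-b * y k ^ 2) ≤
      ∫ t in Ioo (c k) (c k + δ / 2), Real.exp (-b * t ^ 2) := by
    intro k hk
    have h := setIntegral_mono_on (μ := volume) (s := Ioo (c k) (c k + δ / 2))
      (f := fun _ => Real.exp (-b * y k ^ 2)) (g := fun t => Real.exp (-b * t ^ 2))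
      (integrableOn_const (by simp)) hint.integrableOn measurableSet_Ioo (by
        intro t ht
        have := sq_le_sq.2 (hc k hk t ht).2
        refine Real.exp_le_exp.2 ?_
        nlinarith)
    have hvol : volume.real (Ioo (c k) (c k + δ / 2)) = δ / 2 := by
      rw [Real.volume_real_Ioo_of_le (by linarith)]
      ring
    rwa [setIntegral_const, hvol, smul_eq_mul] at h
  have hsum : δ / 2 * ∑ k ∈ F, Real.exp (-b * y k ^ 2) ≤ √(π / b) := by
    rw [← integral_gaussian, Finset.mul_sum]
    refine (Finset.sum_le_sum hlower).trans ?_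
    rw [← integral_biUnion_finset F (fun _ _ => measurableSet_Ioo) ?_
      (fun _ _ => hint.integrableOn)]
    · exact setIntegral_le_integral hint (Filter.Eventually.of_forall fun t => (Real.exp_pos _).le)
    · intro k hk l hl hkl
      refine Set.disjoint_left.2 fun t htk htl => ?_
      have h1 := (hc k hk t htk).1
      have h2 := (hc l hl t htl).1
      have h3 := hsep k hk l hl hkl
      have h4 : |y k - y l| ≤ |t - y k| + |t - y l| := by
        rw [abs_sub_comm t (y k)]
        exact abs_sub_le _ _ _
      linarith
  calc ∑ k ∈ F, Real.exp (-b * y k ^ 2)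
      = 2 / δ * (δ / 2 * ∑ k ∈ F, Real.exp (-b * y k ^ 2)) := by field_simp
    _ ≤ 2 / δ * √(π / b) := by gcongr

theorem matern_nonneg {a z : ℝ} (ha : 0 < a) (hz : 0 ≤ z) : 0 ≤ matern a z := by
  have hΓ := Real.Gamma_pos_of_pos ha
  have hK : 0 ≤ matK a z :=
    mul_nonneg (by norm_num) (integral_nonneg fun t => (Real.exp_pos _).le)
  rw [matern]
  split_ifs <;> positivity

theorem sum_matern_le_of_separated {ι : Type*} (F : Finset ι) (y : ι → ℝ) {a δ : ℝ}
    (ha : 0 < a) (hδ : 0 < δ) (hy : ∀ k ∈ F, δ ≤ |y k|)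
    (hsep : ∀ k ∈ F, ∀ l ∈ F, k ≠ l → δ ≤ |y k - y l|) :
    ∑ k ∈ F, matern a |y k| ≤
      4 * Real.Gamma (a + 1 / 2) * Real.Gamma (1 / 2) / (δ * Real.Gamma a) := by
  have hΓ := Real.Gamma_pos_of_pos ha
  have hconv := (Real.GammaIntegral_convergent (s := a + 1 / 2) (by linarith)).const_mul
    (4 * √π / δ)
  calc ∑ k ∈ F, matern a |y k|
      = (Real.Gamma a)⁻¹ * ∫ s in Ioi (0 : ℝ), ∑ k ∈ F,
          Real.exp (-s) * s ^ (a - 1) * Real.exp (-(1 / (4 * s)) * |y k| ^ 2) := by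
        rw [integral_finsetSum _ fun k _ => integrableOn_exp_mul_rpow_mul_gaussian ha _,
          Finset.mul_sum]
        exact Finset.sum_congr rfl fun k hk => matern_eq_integral_Ioi a (hδ.trans_le (hy k hk))
    _ ≤ (Real.Gamma a)⁻¹ * ∫ s in Ioi (0 : ℝ),
          4 * √π / δ * (Real.exp (-s) * s ^ (a + 1 / 2 - 1)) := by
        refine mul_le_mul_of_nonneg_left (setIntegral_mono_on
          (integrable_finsetSum _ fun k _ => integrableOn_exp_mul_rpow_mul_gaussian ha _)
          hconv measurableSet_Ioi fun s hs => ?_) (by positivity)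
        have hs' : (0 : ℝ) < s := hs
        have h := sum_gaussian_le_of_separated F y hδ (b := 1 / (4 * s)) (by positivity) hy hsep
        have hsqrt : √(π / (1 / (4 * s))) = 2 * √π * s ^ (1 / 2 : ℝ) := by
          rw [← Real.sqrt_eq_rpow, show π / (1 / (4 * s)) = 2 ^ 2 * π * s by field_simp; norm_num,
            Real.sqrt_mul (by positivity), Real.sqrt_mul (by positivity),
            Real.sqrt_sq (by norm_num)]
        rw [hsqrt] at h
        simp only [sq_abs]
        rw [← Finset.mul_sum, show a + 1 / 2 - 1 = a - 1 + 1 / 2 by ring, Real.rpow_add hs']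
        calc _ ≤ Real.exp (-s) * s ^ (a - 1) * (2 / δ * (2 * √π * s ^ (1 / 2 : ℝ))) := by gcongr
          _ = _ := by ring
    _ = 4 * Real.Gamma (a + 1 / 2) * Real.Gamma (1 / 2) / (δ * Real.Gamma a) := by
        rw [integral_const_mul, ← Real.Gamma_eq_integral (by linarith), Real.Gamma_one_half_eq]
        field_simp

section SchurTest

variable {ι : Type*} {r : ι → ι → ℝ} {θ : ℝ}

theorem lp_two_summable_sq (a : lp (fun _ : ι => ℂ) 2) : Summable fun k => ‖a k‖ ^ 2 := by
  have h := (lp.memℓp a).summable (by norm_num)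
  simpa using h

theorem lp_two_norm_sq (a : lp (fun _ : ι => ℂ) 2) : ‖a‖ ^ 2 = ∑' k, ‖a k‖ ^ 2 := by
  have h := lp.norm_rpow_eq_tsum (p := 2) (by norm_num) a
  simpa using h

theorem summable_mul_of_row_sum_le (hr : ∀ j k, 0 ≤ r j k)
    (hrow : ∀ j (F : Finset ι), ∑ k ∈ F, r j k ≤ θ) (a : lp (fun _ : ι => ℂ) 2) (j : ι) :
    Summable fun k => (r j k : ℂ) * a k := by
  have hs : Summable (r j) := summable_of_sum_le (hr j) (hrow j)
  refine Summable.of_norm_bounded (hs.mul_right ‖a‖) fun k => ?_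
  rw [norm_mul, Complex.norm_real, Real.norm_of_nonneg (hr j k)]
  exact mul_le_mul_of_nonneg_left (lp.norm_apply_le_norm (by norm_num) a k) (hr j k)

theorem summable_mul_norm_sq_of_row_sum_le (hr : ∀ j k, 0 ≤ r j k)
    (hrow : ∀ j (F : Finset ι), ∑ k ∈ F, r j k ≤ θ) (a : lp (fun _ : ι => ℂ) 2) (j : ι) :
    Summable fun k => r j k * ‖a k‖ ^ 2 := by
  refine Summable.of_nonneg_of_le (fun k => mul_nonneg (hr j k) (by positivity)) (fun k => ?_)
    ((lp_two_summable_sq a).mul_left θ)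
  have := hrow j {k}
  rw [Finset.sum_singleton] at this
  gcongr

theorem norm_tsum_mul_sq_le_of_row_sum_le (hr : ∀ j k, 0 ≤ r j k)
    (hrow : ∀ j (F : Finset ι), ∑ k ∈ F, r j k ≤ θ) (a : lp (fun _ : ι => ℂ) 2) (j : ι) :
    ‖∑' k, (r j k : ℂ) * a k‖ ^ 2 ≤ θ * ∑' k, r j k * ‖a k‖ ^ 2 := by
  have hθ : 0 ≤ θ := by simpa using hrow j ∅
  have hs := summable_mul_norm_sq_of_row_sum_le hr hrow a j
  have hnn : ∀ k, 0 ≤ r j k * ‖a k‖ ^ 2 := fun k => mul_nonneg (hr j k) (by positivity)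
  have hbound : ‖∑' k, (r j k : ℂ) * a k‖ ≤ √(θ * ∑' k, r j k * ‖a k‖ ^ 2) := by
    refine (norm_tsum_le_tsum_norm (summable_mul_of_row_sum_le hr hrow a j).norm).trans ?_
    refine Real.tsum_le_of_sum_le (fun k => norm_nonneg _) fun F => Real.le_sqrt_of_sq_le ?_
    refine (Finset.sum_sq_le_sum_mul_sum_of_sq_le_mul F (f := fun k => r j k)
      (g := fun k => r j k * ‖a k‖ ^ 2) (fun k _ => hr j k) (fun k _ => hnn k)
      fun k _ => le_of_eq ?_).trans ?_
    · rw [norm_mul, Complex.norm_real, Real.norm_of_nonneg (hr j k)]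
      ring
    · exact mul_le_mul (hrow j F) (hs.sum_le_tsum F fun k _ => hnn k)
        (Finset.sum_nonneg fun k _ => hnn k) hθ
  calc ‖∑' k, (r j k : ℂ) * a k‖ ^ 2 ≤ √(θ * ∑' k, r j k * ‖a k‖ ^ 2) ^ 2 := by gcongr
    _ = _ := Real.sq_sqrt (mul_nonneg hθ (tsum_nonneg hnn))

theorem sum_norm_tsum_mul_sq_le (hθ : 0 ≤ θ) (hr : ∀ j k, 0 ≤ r j k)
    (hsymm : ∀ j k, r j k = r k j)
    (hrow : ∀ j (F : Finset ι), ∑ k ∈ F, r j k ≤ θ) (a : lp (fun _ : ι => ℂ) 2) (F : Finset ι) :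
    ∑ j ∈ F, ‖∑' k, (r j k : ℂ) * a k‖ ^ 2 ≤ (θ * ‖a‖) ^ 2 := by
  have hs := summable_mul_norm_sq_of_row_sum_le hr hrow a
  calc ∑ j ∈ F, ‖∑' k, (r j k : ℂ) * a k‖ ^ 2
      ≤ ∑ j ∈ F, θ * ∑' k, r j k * ‖a k‖ ^ 2 :=
        Finset.sum_le_sum fun j _ => norm_tsum_mul_sq_le_of_row_sum_le hr hrow a j
    _ = θ * ∑' k, ∑ j ∈ F, r j k * ‖a k‖ ^ 2 := by
        rw [← Finset.mul_sum, Summable.tsum_finsetSum fun j _ => hs j]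
    _ ≤ θ * ∑' k, θ * ‖a k‖ ^ 2 := by
        refine mul_le_mul_of_nonneg_left (Summable.tsum_le_tsum (fun k => ?_)
          (summable_sum fun j _ => hs j) ((lp_two_summable_sq a).mul_left θ)) hθ
        rw [← Finset.sum_mul]
        refine mul_le_mul_of_nonneg_right ?_ (by positivity)
        simpa only [hsymm] using hrow k F
    _ = (θ * ‖a‖) ^ 2 := by
        rw [tsum_mul_left, ← lp_two_norm_sq]
        ring

theorem exists_clm_of_row_sum_le (hθ : 0 ≤ θ) (hr : ∀ j k, 0 ≤ r j k)
    (hsymm : ∀ j k, r j k = r k j) (hrow : ∀ j (F : Finset ι), ∑ k ∈ F, r j k ≤ θ) :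
    ∃ R : lp (fun _ : ι => ℂ) 2 →L[ℂ] lp (fun _ : ι => ℂ) 2, ‖R‖ ≤ θ ∧
      ∀ (a : lp (fun _ : ι => ℂ) 2) (j : ι), R a j = ∑' k, (r j k : ℂ) * a k := by
  have hbound := sum_norm_tsum_mul_sq_le hθ hr hsymm hrow
  have hs := summable_mul_of_row_sum_le hr hrow
  let L : lp (fun _ : ι => ℂ) 2 →ₗ[ℂ] lp (fun _ : ι => ℂ) 2 :=
    { toFun := fun a => ⟨fun j => ∑' k, (r j k : ℂ) * a k, memℓp_gen' (C := (θ * ‖a‖) ^ 2)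
        fun F => by simpa using hbound a F⟩
      map_add' := fun a b => by
        ext j
        simp only [lp.coeFn_add, Pi.add_apply, mul_add]
        exact (hs a j).tsum_add (hs b j)
      map_smul' := fun c a => by
        ext j
        simp only [lp.coeFn_smul, Pi.smul_apply, smul_eq_mul, RingHom.id_apply, mul_left_comm _ c]
        exact tsum_mul_left }
  refine ⟨L.mkContinuous θ fun a => ?_, L.mkContinuous_norm_le hθ _, fun a j => rfl⟩
  refine lp.norm_le_of_forall_sum_le (by norm_num) (by positivity) fun F => ?_
  simpa [L] using hbound a F

end SchurTest

theorem matern_schoenberg_invertible (α : ℝ) (hα : 0 < α) (x : ℕ → ℝ) (δ : ℝ)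
    (hsep : ∀ j k : ℕ, j ≠ k → δ ≤ |x j - x k|)
    (hδ : 4 * Real.Gamma (α + 1 / 2) * Real.Gamma (1 / 2) / Real.Gamma α < δ)
    (θ : ℝ)
    (hθ : θ = 4 * Real.Gamma (α + 1 / 2) * Real.Gamma (1 / 2) / (δ * Real.Gamma α)) :
    θ < 1 ∧
      (∀ a : ℕ → ℂ, Summable (fun j : ℕ => ‖a j‖ ^ 2) →
        (1 - θ) * (∑' j : ℕ, ‖a j‖ ^ 2) ≤
          (∑' j : ℕ, ∑' k : ℕ,
            ((matern α |x j - x k| : ℝ) : ℂ) * a j * (starRingEnd ℂ) (a k)).re) ∧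
      ∃ T : lp (fun _ : ℕ => ℂ) 2 ≃L[ℂ] lp (fun _ : ℕ => ℂ) 2,
        ∀ (a : lp (fun _ : ℕ => ℂ) 2) (j : ℕ),
          (T a : ∀ _ : ℕ, ℂ) j = ∑' k : ℕ, ((matern α |x j - x k| : ℝ) : ℂ) * a k := by
  have hΓ := Real.Gamma_pos_of_pos hα
  have hΓ' : 0 < Real.Gamma (α + 1 / 2) := Real.Gamma_pos_of_pos (by linarith)
  have hΓ'' : 0 < Real.Gamma (1 / 2) := Real.Gamma_pos_of_pos (by norm_num)
  have hδ0 : 0 < δ := lt_trans (by positivity) hδ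
  have hθ0 : 0 ≤ θ := by rw [hθ]; positivity
  have hθ1 : θ < 1 := by
    rw [hθ, div_lt_one (by positivity)]
    rwa [div_lt_iff₀ hΓ] at hδ
  let r : ℕ → ℕ → ℝ := fun j k => if j = k then 0 else matern α |x j - x k|
  have hr : ∀ j k, 0 ≤ r j k := by
    intro j k
    simp only [r]
    split_ifs
    exacts [le_rfl, matern_nonneg hα (abs_nonneg _)]
  have hsymm : ∀ j k, r j k = r k j := by
    intro j k
    simp only [r, eq_comm (a := j), abs_sub_comm (x j)]
  have hrow : ∀ j (F : Finset ℕ), ∑ k ∈ F, r j k ≤ θ := by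
    intro j F
    calc ∑ k ∈ F, r j k = ∑ k ∈ F with j ≠ k, matern α |x j - x k| := by
          rw [Finset.sum_filter]
          exact Finset.sum_congr rfl fun k _ => by simp only [r, ite_not]
      _ ≤ θ := by
          rw [hθ]
          refine sum_matern_le_of_separated _ (fun k => x j - x k) hα hδ0
            (fun k hk => hsep j k (Finset.mem_filter.1 hk).2) fun k _ l _ hkl => ?_
          rw [sub_sub_sub_cancel_left]
          exact hsep l k hkl.symm
  obtain ⟨R, hR, hRapply⟩ := exists_clm_of_row_sum_le hθ0 hr hsymm hrow
  have happly : ∀ (a : lp (fun _ : ℕ => ℂ) 2) (j : ℕ),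
      ∑' k : ℕ, ((matern α |x j - x k| : ℝ) : ℂ) * a k = a j + R a j := by
    intro a j
    have hsplit : ∀ k, ((matern α |x j - x k| : ℝ) : ℂ) * a k =
        (if k = j then a j else 0) + (r j k : ℂ) * a k := by
      intro k
      by_cases h : k = j
      · subst h
        simp [r, matern]
      · simp [r, h, Ne.symm h]
    simp only [hsplit]
    rw [Summable.tsum_add (summable_of_hasFiniteSupport (by
      exact (Set.finite_singleton j).subset fun k hk => by
        by_contra h
        exact hk (if_neg h))) (summable_mul_of_row_sum_le hr hrow a j), tsum_ite_eq, hRapply]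
  refine ⟨hθ1, fun a ha => ?_, ?_⟩
  · let v : lp (fun _ : ℕ => ℂ) 2 := ⟨a, memℓp_gen (by simpa using ha)⟩
    have hform : ∀ j, ∑' k : ℕ, ((matern α |x j - x k| : ℝ) : ℂ) * a j * (starRingEnd ℂ) (a k) =
        inner ℂ ((v + R v) j) (v j) := by
      intro j
      rw [lp.coeFn_add, Pi.add_apply, ← happly, RCLike.inner_apply, Complex.conj_tsum,
        ← tsum_mul_left]
      refine tsum_congr fun k => ?_
      rw [map_mul, Complex.conj_ofReal]
      ring
    simp only [hform]
    rw [← lp.inner_eq_tsum, inner_add_left, Complex.add_re, ← lp_two_norm_sq v]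
    have h1 : (inner ℂ v v).re = ‖v‖ ^ 2 := inner_self_eq_norm_sq (𝕜 := ℂ) v
    have h2 : |(inner ℂ (R v) v).re| ≤ θ * ‖v‖ ^ 2 := by
      refine (Complex.abs_re_le_norm _).trans ((norm_inner_le_norm _ _).trans ?_)
      calc ‖R v‖ * ‖v‖ ≤ θ * ‖v‖ * ‖v‖ := by
            gcongr
            exact R.le_of_opNorm_le hR v
        _ = θ * ‖v‖ ^ 2 := by ring
    linarith [(abs_le.1 h2).1]
  · refine ⟨ContinuousLinearEquiv.ofUnit
      (Units.oneSub (-R) (by rw [norm_neg]; exact hR.trans_lt hθ1)), fun a j => ?_⟩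
    rw [happly]
    change ((1 - -R : lp (fun _ : ℕ => ℂ) 2 →L[ℂ] lp (fun _ : ℕ => ℂ) 2) a) j = _
    simp
end

section
/- Let n be a positive integer, 1 ≤ d ≤ n, β > n/2, and let X = {x_j : j ∈ ℕ} ⊂ ℝⁿ be a set of distinct points with separation δ = inf_{j ≠ k} |x_j − x_k| > 0 whose linear span has dimension d. Then for every square-summable complex sequence (a_j), Σ_{j,k ∈ ℕ} (1 + |x_j − x_k|²)^{−β} |a_j| |a_k| ≤ (1 + d(5^d − 1) B(β − d/2, d/2) / (2 δ^d)) · Σ_{j ∈ ℕ} |a_j|². -/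
open MeasureTheory Real Set

/-- For a `δ`-separated family in a normed space of dimension `d`, volume comparison bounds the
number of points at distance between `m δ` and `(m + 1) δ` from a given point. -/
theorem card_add_pow_le_of_separated_annulus {ι E : Type*} [NormedAddCommGroup E]
    [NormedSpace ℝ E] [FiniteDimensional ℝ E] (s : Finset ι) (y : ι → E) (c : E) {δ m : ℝ}
    (hδ : 0 < δ) (hm : 1 ≤ m) (hsep : ∀ j ∈ s, ∀ k ∈ s, j ≠ k → δ ≤ ‖y j - y k‖)
    (hlow : ∀ k ∈ s, m * δ ≤ ‖y k - c‖) (hup : ∀ k ∈ s, ‖y k - c‖ ≤ (m + 1) * δ) :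
    (s.card : ℝ) + (2 * m - 1) ^ Module.finrank ℝ E ≤ (2 * m + 3) ^ Module.finrank ℝ E := by
  borelize E
  let μ : Measure E := Measure.addHaar
  have hball (z : E) {r : ℝ} (hr : 0 < r) :
      μ.real (Metric.ball z (r * (δ / 2))) =
        r ^ Module.finrank ℝ E * μ.real (Metric.ball 0 (δ / 2)) := by
    rw [measureReal_def, measureReal_def, Measure.addHaar_ball_mul_of_pos μ z hr,
      ENNReal.toReal_mul, ENNReal.toReal_ofReal (by positivity)]
  have hpos : 0 < μ.real (Metric.ball (0 : E) (δ / 2)) :=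
    ENNReal.toReal_pos (Metric.measure_ball_pos _ _ (by positivity)).ne' measure_ball_lt_top.ne
  have hdisj : (s : Set ι).PairwiseDisjoint fun k => Metric.ball (y k) (1 * (δ / 2)) := by
    intro j hj k hk hjk
    apply Metric.ball_disjoint_ball
    rw [dist_eq_norm]
    linarith [hsep j hj k hk hjk]
  have hdisj' : Disjoint (⋃ k ∈ s, Metric.ball (y k) (1 * (δ / 2)))
      (Metric.ball c ((2 * m - 1) * (δ / 2))) := by
    simp only [Set.disjoint_iUnion_left]
    intro k hk
    apply Metric.ball_disjoint_ball
    rw [dist_eq_norm]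
    linarith [hlow k hk]
  have hsub : (⋃ k ∈ s, Metric.ball (y k) (1 * (δ / 2))) ∪
      Metric.ball c ((2 * m - 1) * (δ / 2)) ⊆ Metric.ball c ((2 * m + 3) * (δ / 2)) := by
    refine Set.union_subset (Set.iUnion₂_subset fun k hk => ?_) (Metric.ball_subset_ball ?_)
    · apply Metric.ball_subset_ball'
      rw [dist_eq_norm]
      linarith [hup k hk]
    · gcongr
      linarith
  have hU : μ (⋃ k ∈ s, Metric.ball (y k) (1 * (δ / 2))) ≠ ⊤ :=
    ((measure_mono (Set.subset_union_left.trans hsub)).trans_lt measure_ball_lt_top).ne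
  have h := measureReal_mono (μ := μ) hsub measure_ball_lt_top.ne
  rw [measureReal_union hdisj' measurableSet_ball hU measure_ball_lt_top.ne,
    measureReal_biUnion_finset hdisj (fun _ _ => measurableSet_ball)
      (fun _ _ => measure_ball_lt_top.ne)] at h
  rw [Finset.sum_congr rfl fun k _ => hball (y k) one_pos,
    hball c (show 0 < 2 * m - 1 by linarith), hball c (show 0 < 2 * m + 3 by linarith),
    Finset.sum_const, nsmul_eq_mul, one_pow, one_mul, ← add_mul] at h
  exact le_of_mul_le_mul_right h hpos

theorem two_mul_add_three_pow_sub_le {m : ℝ} (hm : 1 ≤ m) {d : ℕ} (hd : 1 ≤ d) :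
    (2 * m + 3) ^ d - (2 * m - 1) ^ d ≤ ((5 : ℝ) ^ d - 1) * m ^ (d - 1) := by
  have h5 : ((5 : ℝ) ^ d - 1) = (2 + 3) ^ d - (2 + -1) ^ d := by norm_num
  rw [h5, sub_eq_add_neg (2 * m) 1, add_pow, add_pow, add_pow, add_pow,
    ← Finset.sum_sub_distrib, ← Finset.sum_sub_distrib, Finset.sum_mul]
  refine Finset.sum_le_sum fun i hi => ?_
  have hcoef : (0 : ℝ) ≤ 3 ^ (d - i) - (-1) ^ (d - i) := by
    rw [sub_nonneg]
    calc (-1 : ℝ) ^ (d - i) ≤ |(-1) ^ (d - i)| := le_abs_self _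
      _ = 1 := by simp
      _ ≤ 3 ^ (d - i) := one_le_pow₀ (by norm_num)
  rcases (Nat.lt_succ_iff.mp (Finset.mem_range.mp hi)).eq_or_lt with rfl | hid
  · simp
  · have hmi : m ^ i ≤ m ^ (d - 1) := pow_le_pow_right₀ hm (by omega)
    calc (2 * m) ^ i * 3 ^ (d - i) * (d.choose i : ℝ) - (2 * m) ^ i * (-1) ^ (d - i) * d.choose i
        = (2 ^ i * (3 ^ (d - i) - (-1) ^ (d - i)) * d.choose i) * m ^ i := by
          rw [mul_pow]; ring
      _ ≤ (2 ^ i * (3 ^ (d - i) - (-1) ^ (d - i)) * d.choose i) * m ^ (d - 1) := by gcongr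
      _ = _ := by ring

theorem integrableOn_matBeta_integrand {a b : ℝ} (ha : 0 < a) (hb : 0 < b) :
    IntegrableOn (fun t : ℝ => t ^ (a - 1) * (1 - t) ^ (b - 1)) (Ioo 0 1) := by
  have h := (Complex.betaIntegral_convergent (u := a) (v := b) (by simpa) (by simpa)).norm
  rw [intervalIntegrable_iff_integrableOn_Ioo_of_le zero_le_one] at h
  refine h.congr_fun (fun t ht => ?_) measurableSet_Ioo
  have h1 : (0 : ℝ) < 1 - t := by linarith [ht.2]
  have e1 : (1 : ℂ) - t = ((1 - t : ℝ) : ℂ) := by push_cast; ring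
  simp only [norm_mul]
  rw [e1, Complex.norm_cpow_eq_rpow_re_of_pos ht.1, Complex.norm_cpow_eq_rpow_re_of_pos h1]
  simp

theorem image_inv_one_add_sq : (fun t : ℝ => (1 + t ^ 2)⁻¹) '' Ioi 0 = Ioo 0 1 := by
  ext u
  simp only [Set.mem_image, Set.mem_Ioi, Set.mem_Ioo]
  constructor
  · rintro ⟨t, ht, rfl⟩
    exact ⟨by positivity, inv_lt_one_of_one_lt₀ (by nlinarith)⟩
  · rintro ⟨h0, h1⟩
    have : 0 < u⁻¹ - 1 := by linarith [(one_lt_inv₀ h0).2 h1]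
    refine ⟨√(u⁻¹ - 1), Real.sqrt_pos.2 this, ?_⟩
    rw [Real.sq_sqrt this.le]
    simp

/-- The substitution `u = (1 + t ^ 2)⁻¹` in the Beta integral. -/
theorem integral_pow_mul_inverse_multiquadric {d : ℕ} (hd : 1 ≤ d) {β : ℝ}
    (hβ : (d : ℝ) / 2 < β) :
    IntegrableOn (fun t : ℝ => t ^ (d - 1) * (1 + t ^ 2) ^ (-β)) (Ioi 0) ∧
      ∫ t in Ioi (0 : ℝ), t ^ (d - 1) * (1 + t ^ 2) ^ (-β) =
        matBeta (β - d / 2) (d / 2) / 2 := by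
  have hd0 : (0 : ℝ) < d := by exact_mod_cast hd
  let g : ℝ → ℝ := fun u => u ^ (β - (d : ℝ) / 2 - 1) * (1 - u) ^ ((d : ℝ) / 2 - 1)
  have hderiv : ∀ t ∈ Ioi (0 : ℝ), HasDerivWithinAt (fun t : ℝ => (1 + t ^ 2)⁻¹)
      (-(2 * t) / (1 + t ^ 2) ^ 2) (Ioi 0) t := by
    intro t _
    have h : HasDerivAt (fun t : ℝ => 1 + t ^ 2) (2 * t) t := by
      simpa using (hasDerivAt_pow 2 t).const_add 1
    exact (h.fun_inv (by positivity)).hasDerivWithinAt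
  have hinj : InjOn (fun t : ℝ => (1 + t ^ 2)⁻¹) (Ioi 0) := by
    intro s hs t ht hst
    have h2 : s ^ 2 = t ^ 2 := add_left_cancel (inv_injective hst)
    exact (pow_left_inj₀ (le_of_lt hs) (le_of_lt ht) two_ne_zero).1 h2
  have hval : ∀ t ∈ Ioi (0 : ℝ), |(-(2 * t) / (1 + t ^ 2) ^ 2)| • g ((1 + t ^ 2)⁻¹) =
      2 * (t ^ (d - 1) * (1 + t ^ 2) ^ (-β)) := by
    intro t ht
    have ht0 : (0 : ℝ) < t := ht
    have hA : 0 < 1 + t ^ 2 := by positivity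
    have e1 : 1 - (1 + t ^ 2)⁻¹ = t ^ 2 * (1 + t ^ 2)⁻¹ := by field_simp; ring
    have e2 : |(-(2 * t) / (1 + t ^ 2) ^ 2)| = 2 * t * (1 + t ^ 2) ^ (-2 : ℝ) := by
      rw [neg_div, abs_neg, abs_of_nonneg (by positivity), Real.rpow_neg hA.le, div_eq_mul_inv]
      norm_cast
    have e3 : (t ^ 2) ^ ((d : ℝ) / 2 - 1) * t = t ^ (d - 1) := by
      rw [← Real.rpow_natCast t 2, ← Real.rpow_mul ht0.le, ← Real.rpow_add_one ht0.ne',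
        ← Real.rpow_natCast t (d - 1), Nat.cast_sub hd]
      congr 1
      push_cast
      ring
    have e4 : (1 + t ^ 2) ^ (-2 : ℝ) * ((1 + t ^ 2) ^ (-(β - (d : ℝ) / 2 - 1)) *
        (1 + t ^ 2) ^ (-((d : ℝ) / 2 - 1))) = (1 + t ^ 2) ^ (-β) := by
      rw [← Real.rpow_add hA, ← Real.rpow_add hA]
      congr 1
      ring
    rw [e2, smul_eq_mul]
    simp only [g]
    rw [e1, Real.mul_rpow (by positivity) (by positivity), Real.inv_rpow hA.le,
      Real.inv_rpow hA.le, ← Real.rpow_neg hA.le, ← Real.rpow_neg hA.le, ← e3, ← e4]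
    ring
  have hg : IntegrableOn g (Ioo 0 1) :=
    integrableOn_matBeta_integrand (sub_pos.2 hβ) (by positivity)
  have hInt := (integrableOn_image_iff_integrableOn_abs_deriv_smul measurableSet_Ioi hderiv hinj
    g).1 (image_inv_one_add_sq ▸ hg)
  have heq := integral_image_eq_integral_abs_deriv_smul measurableSet_Ioi hderiv hinj g
  rw [image_inv_one_add_sq, setIntegral_congr_fun measurableSet_Ioi hval,
    integral_const_mul] at heq
  constructor
  · have h := (hInt.congr_fun hval measurableSet_Ioi).const_mul (1 / 2)
    simpa [IntegrableOn] using h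
  · rw [matBeta, intervalIntegral.integral_of_le zero_le_one, integral_Ioc_eq_integral_Ioo]
    simp only [g] at heq
    rw [heq]
    ring

theorem sub_one_pow_add_pow_le {r : ℝ} (hr : 1 ≤ r) {d : ℕ} (hd : 1 ≤ d) :
    (r - 1) ^ d + r ^ (d - 1) ≤ r ^ d := by
  obtain ⟨e, rfl⟩ := Nat.exists_eq_add_of_le' hd
  have h : (r - 1) ^ e ≤ r ^ e := pow_le_pow_left₀ (by linarith) (by linarith) e
  have h' := mul_le_mul_of_nonneg_right h (show 0 ≤ r - 1 by linarith)
  rw [Nat.add_sub_cancel, pow_succ, pow_succ]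
  linarith

/-- Comparison of the sampled radial sum with the radial integral. -/
theorem sum_pow_mul_inverse_multiquadric_le {d : ℕ} (hd : 1 ≤ d) {β δ : ℝ}
    (hβ : (d : ℝ) / 2 < β) (hδ : 0 < δ) (N : ℕ) :
    ∑ m ∈ Finset.range N, ((m : ℝ) + 1) ^ (d - 1) * (1 + (((m : ℝ) + 1) * δ) ^ 2) ^ (-β) ≤
      d * matBeta (β - d / 2) (d / 2) / (2 * δ ^ d) := by
  have hd0 : (0 : ℝ) < d := by exact_mod_cast hd
  have hβ0 : 0 ≤ β := by linarith [div_pos hd0 two_pos]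
  let f : ℝ → ℝ := fun t => t ^ (d - 1) * (1 + t ^ 2) ^ (-β)
  have hf : Continuous f := by
    refine (continuous_pow _).mul (Continuous.rpow_const (by fun_prop) fun t => Or.inl ?_)
    positivity
  have hterm (m : ℕ) :
      ((m : ℝ) + 1) ^ (d - 1) * (1 + (((m : ℝ) + 1) * δ) ^ 2) ^ (-β) * (δ ^ d / d) ≤
        ∫ t in (m * δ : ℝ)..((m + 1 : ℕ) * δ : ℝ), f t := by
    set c : ℝ := (1 + (((m : ℝ) + 1) * δ) ^ 2) ^ (-β) with hc
    have hc0 : 0 ≤ c := by positivity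
    have hpow : (((m : ℝ) + 1) ^ (d - 1)) * δ ^ d ≤
        (((m + 1 : ℕ) : ℝ) * δ) ^ d - ((m : ℝ) * δ) ^ d := by
      have h := sub_one_pow_add_pow_le (r := (m : ℝ) + 1) (by simp) hd
      rw [add_sub_cancel_right] at h
      have h' := mul_le_mul_of_nonneg_right h (pow_nonneg hδ.le d)
      push_cast
      rw [mul_pow, mul_pow]
      linarith
    calc (m + 1 : ℝ) ^ (d - 1) * c * (δ ^ d / d)
        = c * (((m + 1 : ℝ) ^ (d - 1) * δ ^ d) / d) := by ring
      _ ≤ c * (((((m + 1 : ℕ) : ℝ) * δ) ^ d - ((m : ℝ) * δ) ^ d) / d) := by gcongr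
      _ = ∫ t in (m * δ : ℝ)..((m + 1 : ℕ) * δ : ℝ), c * t ^ (d - 1) := by
        rw [intervalIntegral.integral_const_mul, integral_pow, Nat.sub_add_cancel hd,
          Nat.cast_sub hd]
        simp
      _ ≤ _ := by
        apply intervalIntegral.integral_mono_on
        · gcongr
          simp
        · exact (by fun_prop : Continuous fun t : ℝ => c * t ^ (d - 1)).intervalIntegrable _ _
        · exact hf.intervalIntegrable _ _
        · intro t ht
          have ht0 : 0 ≤ t := le_trans (by positivity) ht.1
          have ht1 : t ≤ (m + 1) * δ := by simpa using ht.2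
          simp only [f]
          rw [mul_comm]
          gcongr
          exact Real.rpow_le_rpow_of_nonpos (by positivity) (by gcongr) (by linarith)
  obtain ⟨hInt, hval⟩ := integral_pow_mul_inverse_multiquadric hd hβ
  have hsum : (∑ m ∈ Finset.range N, ((m : ℝ) + 1) ^ (d - 1) *
      (1 + (((m : ℝ) + 1) * δ) ^ 2) ^ (-β)) * (δ ^ d / d) ≤
        matBeta (β - d / 2) (d / 2) / 2 := by
    rw [Finset.sum_mul, ← hval]
    refine (Finset.sum_le_sum fun m _ => hterm m).trans ?_
    rw [intervalIntegral.sum_integral_adjacent_intervals (a := fun m : ℕ => (m * δ : ℝ))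
      (fun k _ => hf.intervalIntegrable _ _), intervalIntegral.integral_of_le]
    · refine setIntegral_mono_set hInt ?_ ?_
      · filter_upwards [ae_restrict_mem measurableSet_Ioi] with t ht
        have ht0 : (0 : ℝ) < t := ht
        positivity
      · refine (Set.Ioc_subset_Ioi_self.trans ?_).eventuallyLE
        simp
    · gcongr
      simp
  have hk : 0 < δ ^ d / d := by positivity
  rw [← le_div_iff₀ hk] at hsum
  refine hsum.trans_eq ?_
  field_simp

/-- The row sums of the inverse multiquadric matrix over a separated family, diagonal excluded. -/
theorem sum_inverse_multiquadric_le_of_separated {ι E : Type*} [NormedAddCommGroup E]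
    [NormedSpace ℝ E] [FiniteDimensional ℝ E] {d : ℕ} (hd : 1 ≤ d)
    (hfin : Module.finrank ℝ E = d) {β δ : ℝ} (hβ : (d : ℝ) / 2 < β) (hδ : 0 < δ)
    (s : Finset ι) (y : ι → E) (c : E)
    (hsep : ∀ j ∈ s, ∀ k ∈ s, j ≠ k → δ ≤ ‖y j - y k‖) (hc : ∀ k ∈ s, δ ≤ ‖y k - c‖) :
    ∑ k ∈ s, (1 + ‖y k - c‖ ^ 2) ^ (-β) ≤
      d * ((5 : ℝ) ^ d - 1) * matBeta (β - d / 2) (d / 2) / (2 * δ ^ d) := by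
  have hd0 : (0 : ℝ) < d := by exact_mod_cast hd
  have hβ0 : 0 ≤ β := by linarith [div_pos hd0 two_pos]
  let p : ι → ℕ := fun k => ⌊‖y k - c‖ / δ⌋₊ - 1
  have hp (k : ι) (hk : k ∈ s) : ((p k : ℝ) + 1) * δ ≤ ‖y k - c‖ ∧
      ‖y k - c‖ ≤ ((p k : ℝ) + 1 + 1) * δ := by
    have h1 : 1 ≤ ⌊‖y k - c‖ / δ⌋₊ := Nat.one_le_floor_iff _ |>.2 ((one_le_div hδ).2 (hc k hk))
    have e : (p k : ℝ) + 1 = (⌊‖y k - c‖ / δ⌋₊ : ℝ) := by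
      simp only [p]
      rw [Nat.cast_sub h1]
      simp
    rw [e, ← le_div_iff₀ hδ, ← div_le_iff₀ hδ]
    exact ⟨Nat.floor_le (by positivity), (Nat.lt_floor_add_one _).le⟩
  let N := s.sup p + 1
  have hpN : ∀ k ∈ s, p k ∈ Finset.range N := fun k hk =>
    Finset.mem_range.2 (Nat.lt_succ_of_le (Finset.le_sup hk))
  have h5 : (0 : ℝ) ≤ 5 ^ d - 1 := sub_nonneg.2 (one_le_pow₀ (by norm_num))
  calc ∑ k ∈ s, (1 + ‖y k - c‖ ^ 2) ^ (-β)
      ≤ ∑ k ∈ s, (1 + (((p k : ℝ) + 1) * δ) ^ 2) ^ (-β) := by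
        refine Finset.sum_le_sum fun k hk => ?_
        refine Real.rpow_le_rpow_of_nonpos (by positivity) ?_ (by linarith)
        have := (hp k hk).1
        gcongr
    _ = ∑ m ∈ Finset.range N, ∑ k ∈ s with p k = m,
          (1 + (((p k : ℝ) + 1) * δ) ^ 2) ^ (-β) :=
        (Finset.sum_fiberwise_of_maps_to hpN _).symm
    _ ≤ ∑ m ∈ Finset.range N, ((5 : ℝ) ^ d - 1) *
          (((m : ℝ) + 1) ^ (d - 1) * (1 + (((m : ℝ) + 1) * δ) ^ 2) ^ (-β)) := by
        refine Finset.sum_le_sum fun m _ => ?_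
        have hm1 : (1 : ℝ) ≤ (m : ℝ) + 1 := by simp
        have hcard := card_add_pow_le_of_separated_annulus (s.filter fun k => p k = m) y c hδ hm1
          (fun j hj k hk => hsep j (Finset.mem_filter.1 hj).1 k (Finset.mem_filter.1 hk).1)
          (fun k hk => by
            obtain ⟨hks, rfl⟩ := Finset.mem_filter.1 hk
            exact (hp k hks).1)
          (fun k hk => by
            obtain ⟨hks, rfl⟩ := Finset.mem_filter.1 hk
            exact (hp k hks).2)
        rw [hfin] at hcard
        have hpoly := two_mul_add_three_pow_sub_le hm1 hd
        have hconst : ∑ k ∈ s with p k = m, (1 + (((p k : ℝ) + 1) * δ) ^ 2) ^ (-β) =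
            ((s.filter fun k => p k = m).card : ℝ) * (1 + (((m : ℝ) + 1) * δ) ^ 2) ^ (-β) := by
          rw [← nsmul_eq_mul]
          refine Finset.sum_eq_card_nsmul fun k hk => ?_
          rw [(Finset.mem_filter.1 hk).2]
        rw [hconst, ← mul_assoc]
        gcongr
        linarith
    _ = ((5 : ℝ) ^ d - 1) * ∑ m ∈ Finset.range N,
          (((m : ℝ) + 1) ^ (d - 1) * (1 + (((m : ℝ) + 1) * δ) ^ 2) ^ (-β)) := by
        rw [Finset.mul_sum]
    _ ≤ ((5 : ℝ) ^ d - 1) * (d * matBeta (β - d / 2) (d / 2) / (2 * δ ^ d)) := by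
        gcongr
        exact sum_pow_mul_inverse_multiquadric_le hd hβ hδ N
    _ = _ := by ring

/-- Schur's test for a symmetric nonnegative kernel with bounded row sums. -/
theorem tsum_tsum_mul_le_of_row_sum_le {ι : Type*} {K : ι → ι → ℝ} {C : ℝ}
    (hK : ∀ j k, 0 ≤ K j k) (hsymm : ∀ j k, K j k = K k j) (hC : 0 ≤ C)
    (hrow : ∀ j (s : Finset ι), ∑ k ∈ s, K j k ≤ C) {b : ι → ℝ}
    (hb : ∀ j, 0 ≤ b j) (hsum : Summable fun j => b j ^ 2) :
    ∑' j, ∑' k, K j k * b j * b k ≤ C * ∑' j, b j ^ 2 := by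
  have hrowS (j : ι) : Summable (K j) := summable_of_sum_le (hK j) (hrow j)
  have hrowT (j : ι) : ∑' k, K j k ≤ C := (hrowS j).tsum_le_of_sum_le (hrow j)
  have hKC (j k : ι) : K j k ≤ C := by simpa using hrow j {k}
  have hS1 (j : ι) : Summable fun k => K j k * b k ^ 2 :=
    Summable.of_nonneg_of_le (fun k => mul_nonneg (hK j k) (sq_nonneg _))
      (fun k => mul_le_mul_of_nonneg_right (hKC j k) (sq_nonneg _)) (hsum.mul_left C)
  have hS2 (j : ι) : Summable fun k => K j k * b j ^ 2 := (hrowS j).mul_right _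
  have hle (j k : ι) : K j k * b j * b k ≤ (K j k * b j ^ 2 + K j k * b k ^ 2) * (1 / 2) := by
    nlinarith [mul_nonneg (hK j k) (sq_nonneg (b j - b k))]
  have hS (j : ι) : Summable fun k => K j k * b j * b k :=
    Summable.of_nonneg_of_le (fun k => mul_nonneg (mul_nonneg (hK j k) (hb j)) (hb k)) (hle j)
      (((hS2 j).add (hS1 j)).mul_right _)
  refine tsum_le_of_sum_le' (mul_nonneg hC (tsum_nonneg fun j => sq_nonneg _)) fun s => ?_
  have hinner (j : ι) : ∑' k, K j k * b j * b k ≤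
      (C * b j ^ 2 + ∑' k, K j k * b k ^ 2) * (1 / 2) := by
    refine ((hS j).tsum_le_tsum (hle j) (((hS2 j).add (hS1 j)).mul_right _)).trans ?_
    rw [tsum_mul_right, (hS2 j).tsum_add (hS1 j), tsum_mul_right]
    gcongr
    exact hrowT j
  have hfirst : ∑ j ∈ s, C * b j ^ 2 ≤ C * ∑' j, b j ^ 2 := by
    rw [← Finset.mul_sum]
    gcongr
    exact hsum.sum_le_tsum s fun j _ => sq_nonneg _
  have hsecond : ∑ j ∈ s, ∑' k, K j k * b k ^ 2 ≤ C * ∑' j, b j ^ 2 := by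
    rw [← Summable.tsum_finsetSum fun j _ => hS1 j, ← tsum_mul_left]
    refine Summable.tsum_le_tsum (fun k => ?_) (summable_sum fun j _ => hS1 j)
      (hsum.mul_left C)
    rw [← Finset.sum_mul]
    gcongr
    simpa only [hsymm k] using hrow k s
  calc ∑ j ∈ s, ∑' k, K j k * b j * b k
      ≤ ∑ j ∈ s, (C * b j ^ 2 + ∑' k, K j k * b k ^ 2) * (1 / 2) :=
        Finset.sum_le_sum fun j _ => hinner j
    _ = (∑ j ∈ s, C * b j ^ 2 + ∑ j ∈ s, ∑' k, K j k * b k ^ 2) * (1 / 2) := by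
        rw [← Finset.sum_mul, Finset.sum_add_distrib]
    _ ≤ C * ∑' j, b j ^ 2 := by linarith

theorem inverse_multiquadric_schoenberg_bound (n d : ℕ) (hn : 0 < n) (hd1 : 1 ≤ d) (hdn : d ≤ n)
    (β : ℝ) (hβ : (n : ℝ) / 2 < β)
    (x : ℕ → EuclideanSpace ℝ (Fin n)) (δ : ℝ) (hδ : 0 < δ)
    (hsep : ∀ j k : ℕ, j ≠ k → δ ≤ ‖x j - x k‖)
    (hspan : Module.finrank ℝ (Submodule.span ℝ (Set.range x)) = d)
    (a : ℕ → ℂ) (ha : Summable fun j : ℕ => ‖a j‖ ^ 2) :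
    (∑' j : ℕ, ∑' k : ℕ, (1 + ‖x j - x k‖ ^ 2) ^ (-β) * ‖a j‖ * ‖a k‖) ≤
      (1 + (d : ℝ) * ((5 : ℝ) ^ d - 1) * matBeta (β - (d : ℝ) / 2) ((d : ℝ) / 2) /
          (2 * δ ^ d)) *
        ∑' j : ℕ, ‖a j‖ ^ 2 := by
  let V := Submodule.span ℝ (Set.range x)
  let y : ℕ → V := fun j => ⟨x j, Submodule.subset_span (Set.mem_range_self j)⟩
  have hy (j k : ℕ) : ‖y j - y k‖ = ‖x j - x k‖ := rfl
  have hβd : (d : ℝ) / 2 < β := by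
    have : (d : ℝ) ≤ n := by exact_mod_cast hdn
    linarith
  have hrow (j : ℕ) (s : Finset ℕ) : ∑ k ∈ s, (1 + ‖x j - x k‖ ^ 2) ^ (-β) ≤
      1 + (d : ℝ) * ((5 : ℝ) ^ d - 1) * matBeta (β - (d : ℝ) / 2) ((d : ℝ) / 2) /
        (2 * δ ^ d) := by
    have hoff := sum_inverse_multiquadric_le_of_separated hd1 hspan hβd hδ (s.erase j) y (y j)
      (fun k _ l _ hkl => hsep k l hkl) (fun k hk => hsep k j (Finset.ne_of_mem_erase hk))
    simp only [hy, fun k => norm_sub_rev (x k) (x j)] at hoff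
    calc ∑ k ∈ s, (1 + ‖x j - x k‖ ^ 2) ^ (-β)
        ≤ ∑ k ∈ insert j (s.erase j), (1 + ‖x j - x k‖ ^ 2) ^ (-β) :=
          Finset.sum_le_sum_of_subset_of_nonneg (Finset.insert_erase_subset j s)
            fun k _ _ => by positivity
      _ = 1 + ∑ k ∈ s.erase j, (1 + ‖x j - x k‖ ^ 2) ^ (-β) := by
          rw [Finset.sum_insert (Finset.notMem_erase j s)]
          simp
      _ ≤ _ := by gcongr
  refine tsum_tsum_mul_le_of_row_sum_le (K := fun j k => (1 + ‖x j - x k‖ ^ 2) ^ (-β))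
    (fun j k => by positivity) (fun j k => by rw [norm_sub_rev])
    (by simpa using hrow 0 ∅) hrow (fun j => norm_nonneg _) ha
end

section
/- Let λ > −1 and let α be real with 2α + λ + 1 > 0. Then ∫₀^∞ (K_α(t) t^α)² t^{2λ+1} dt = √π · Γ(α+λ+1) Γ(2α+λ+1) Γ(λ+1) / (4 Γ(α + λ + 3/2)). -/
open MeasureTheory Real Set

open scoped ENNReal

namespace Real

theorem cosh_add_cosh (x y : ℝ) : cosh (x + y) + cosh (x - y) = 2 * cosh x * cosh y := by
  rw [cosh_add, cosh_sub]; ring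

theorem sigmoid_eq_exp_half_div (x : ℝ) : sigmoid x = exp (x / 2) / (2 * cosh (x / 2)) := by
  have h : exp x = exp (x / 2) * exp (x / 2) := by rw [← exp_add]; ring_nf
  rw [sigmoid_def, cosh_eq, exp_neg, exp_neg, h]
  have := exp_pos (x / 2)
  field_simp

theorem sigmoid_rpow_mul_sigmoid_neg_rpow (p q x : ℝ) :
    sigmoid x ^ p * sigmoid (-x) ^ q =
      exp ((p - q) * (x / 2)) * (2 * cosh (x / 2)) ^ (-(p + q)) := by
  have hc : 0 < 2 * cosh (x / 2) := by positivity
  rw [sigmoid_eq_exp_half_div, sigmoid_eq_exp_half_div, neg_div, cosh_neg,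
    div_rpow (exp_pos _).le hc.le, div_rpow (exp_pos _).le hc.le, ← exp_mul, ← exp_mul,
    rpow_neg hc.le, rpow_add hc,
    show (p - q) * (x / 2) = x / 2 * p + -(x / 2) * q by ring, exp_add]
  have := rpow_pos_of_pos hc p
  have := rpow_pos_of_pos hc q
  field_simp

/-- The Beta integral in the variable `x`, where `sigmoid (c * x)` is the usual variable. -/
theorem lintegral_exp_mul_cosh_rpow {p q c : ℝ} (hp : 0 < p) (hq : 0 < q) (hc : 0 < c) :
    ∫⁻ x : ℝ, ENNReal.ofReal
        (exp ((p - q) * (c * x / 2)) * (2 * cosh (c * x / 2)) ^ (-(p + q))) =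
      ENNReal.ofReal (ProbabilityTheory.beta p q / c) := by
  have hβ := ProbabilityTheory.beta_pos hp hq
  have himage : (fun x : ℝ => sigmoid (c * x)) '' univ = Ioo 0 1 := by
    rw [image_univ, ← range_sigmoid]
    exact (mul_left_surjective₀ hc.ne').range_comp sigmoid
  have hderiv (x : ℝ) : HasDerivAt (fun x : ℝ => sigmoid (c * x))
      (sigmoid (c * x) * (1 - sigmoid (c * x)) * c) x :=
    (hasDerivAt_sigmoid (c * x)).comp x (by simpa using (hasDerivAt_id x).const_mul c)
  have hinj : InjOn (fun x : ℝ => sigmoid (c * x)) univ := fun x _ y _ h =>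
    mul_left_cancel₀ hc.ne' (sigmoid_injective h)
  have key := ProbabilityTheory.lintegral_betaPDF_eq_one hp hq
  rw [ProbabilityTheory.lintegral_betaPDF, ← himage,
    lintegral_image_eq_lintegral_abs_deriv_mul MeasurableSet.univ
      (fun x _ => (hderiv x).hasDerivWithinAt) hinj, setLIntegral_univ] at key
  have hcongr (x : ℝ) :
      ENNReal.ofReal |sigmoid (c * x) * (1 - sigmoid (c * x)) * c| *
        ENNReal.ofReal (1 / ProbabilityTheory.beta p q * sigmoid (c * x) ^ (p - 1) *
          (1 - sigmoid (c * x)) ^ (q - 1)) =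
      ENNReal.ofReal (c / ProbabilityTheory.beta p q) * ENNReal.ofReal
        (exp ((p - q) * (c * x / 2)) * (2 * cosh (c * x / 2)) ^ (-(p + q))) := by
    have h1 := sigmoid_pos (c * x)
    have h2 := sigmoid_pos (-(c * x))
    rw [← sigmoid_rpow_mul_sigmoid_neg_rpow, ← sigmoid_neg, abs_of_pos (by positivity),
      ← ENNReal.ofReal_mul (by positivity), ← ENNReal.ofReal_mul (by positivity),
      rpow_sub_one h1.ne', rpow_sub_one h2.ne']
    congr 1
    field_simp
  simp_rw [hcongr] at key
  rw [lintegral_const_mul _ (by fun_prop)] at key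
  rw [ENNReal.eq_inv_of_mul_eq_one_left ((mul_comm _ _).trans key),
    ← ENNReal.ofReal_inv_of_pos (by positivity), inv_div]

theorem lintegral_rpow_mul_exp_neg_mul_Ioi {a r : ℝ} (ha : 0 < a) (hr : 0 < r) :
    ∫⁻ t in Ioi (0 : ℝ), ENNReal.ofReal (t ^ (a - 1) * exp (-(r * t))) =
      ENNReal.ofReal ((1 / r) ^ a * Gamma a) := by
  have h := integral_rpow_mul_exp_neg_mul_Ioi ha hr
  have hG := Gamma_pos_of_pos ha
  rw [← h, ofReal_integral_eq_lintegral_ofReal]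
  · exact .of_integral_ne_zero (by rw [h]; positivity)
  · refine ae_restrict_of_forall_mem measurableSet_Ioi fun t ht => ?_
    have : 0 < t := ht
    positivity

/-- The integral of `F u v` in the coordinates `u = x + w / 2`, `v = x - w / 2`. -/
theorem lintegral_lintegral_eq_shear {F : ℝ → ℝ → ℝ≥0∞} (hF : Measurable (Function.uncurry F)) :
    ∫⁻ v, ∫⁻ u, F u v = ∫⁻ w : ℝ, ∫⁻ x : ℝ, F (x + w / 2) (x - w / 2) := by
  calc ∫⁻ v, ∫⁻ u, F u v = ∫⁻ v, ∫⁻ w, F (w + v) v :=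
        lintegral_congr fun v => (lintegral_add_right_eq_self (fun u => F u v) v).symm
    _ = ∫⁻ w, ∫⁻ v, F (w + v) v := by
        refine lintegral_lintegral_swap (Measurable.aemeasurable ?_)
        exact hF.comp (f := fun z : ℝ × ℝ => (z.2 + z.1, z.1)) (by fun_prop)
    _ = ∫⁻ w, ∫⁻ x, F (x + w / 2) (x - w / 2) := by
        refine lintegral_congr fun w => ?_
        rw [← lintegral_sub_right_eq_self (fun v => F (w + v) v) (w / 2)]
        refine lintegral_congr fun x => ?_
        congr 1
        ring

end Real

/-- Twice `matK a z`, as an integral with values in `ℝ≥0∞`. -/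
noncomputable def schlaefliLIntegral (a z : ℝ) : ℝ≥0∞ :=
  ∫⁻ t : ℝ, ENNReal.ofReal (Real.exp (-z * Real.cosh t - a * t))

theorem matK_eq_toReal_schlaefliLIntegral (a z : ℝ) :
    matK a z = (1 / 2) * (schlaefliLIntegral a z).toReal := by
  rw [matK, schlaefliLIntegral, integral_eq_lintegral_of_nonneg_ae]
  · exact .of_forall fun t => (Real.exp_pos _).le
  · exact Continuous.aestronglyMeasurable (by fun_prop)

theorem measurable_schlaefliLIntegral (a : ℝ) : Measurable (schlaefliLIntegral a) := by
  unfold schlaefliLIntegral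
  exact Measurable.lintegral_prod_right (by fun_prop)

/-- The Mellin transform at `s` of the square of the Schläfli integral. -/
theorem lintegral_schlaefliLIntegral_sq_mul_rpow {a s : ℝ} (h₁ : 0 < s / 2 - a)
    (h₂ : 0 < s / 2 + a) :
    ∫⁻ t in Ioi (0 : ℝ), schlaefliLIntegral a t ^ 2 * ENNReal.ofReal (t ^ (s - 1)) =
      ENNReal.ofReal (2 ^ s * Real.Gamma s * (ProbabilityTheory.beta (s / 2) (s / 2) / 1) *
        (ProbabilityTheory.beta (s / 2 - a) (s / 2 + a) / 2)) := by
  have hs : 0 < s := by linarith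
  have hG := Real.Gamma_pos_of_pos hs
  have hβ₁ := ProbabilityTheory.beta_pos (half_pos hs) (half_pos hs)
  have hexpand (t : ℝ) (ht : t ∈ Ioi (0 : ℝ)) :
      schlaefliLIntegral a t ^ 2 * ENNReal.ofReal (t ^ (s - 1)) =
      ∫⁻ v : ℝ, ∫⁻ u : ℝ, ENNReal.ofReal (exp (-a * (u + v))) *
        ENNReal.ofReal (t ^ (s - 1) * exp (-((cosh u + cosh v) * t))) := by
    have ht' : 0 < t := ht
    rw [sq]
    nth_rw 2 [schlaefliLIntegral]
    rw [← lintegral_const_mul _ (by fun_prop), ← lintegral_mul_const _ (by fun_prop)]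
    refine lintegral_congr fun v => ?_
    rw [schlaefliLIntegral, ← lintegral_mul_const _ (by fun_prop),
      ← lintegral_mul_const _ (by fun_prop)]
    refine lintegral_congr fun u => ?_
    rw [← ENNReal.ofReal_mul (by positivity), ← ENNReal.ofReal_mul (by positivity),
      ← ENNReal.ofReal_mul (by positivity), ← exp_add, mul_comm (t ^ (s - 1)), ← mul_assoc,
      ← exp_add]
    ring_nf
  have hinner (u v : ℝ) :
      ∫⁻ t in Ioi (0 : ℝ), ENNReal.ofReal (exp (-a * (u + v))) *
        ENNReal.ofReal (t ^ (s - 1) * exp (-((cosh u + cosh v) * t))) =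
      ENNReal.ofReal (exp (-a * (u + v)) * ((1 / (cosh u + cosh v)) ^ s * Real.Gamma s)) := by
    rw [lintegral_const_mul _ (by fun_prop),
      Real.lintegral_rpow_mul_exp_neg_mul_Ioi hs (by positivity),
      ← ENNReal.ofReal_mul (by positivity)]
  have hsplit (w x : ℝ) :
      ENNReal.ofReal (exp (-a * (x + w / 2 + (x - w / 2))) *
        ((1 / (cosh (x + w / 2) + cosh (x - w / 2))) ^ s * Real.Gamma s)) =
      ENNReal.ofReal (2 ^ s * Real.Gamma s) * ENNReal.ofReal
        (exp ((s / 2 - s / 2) * (1 * w / 2)) * (2 * cosh (1 * w / 2)) ^ (-(s / 2 + s / 2))) *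
        ENNReal.ofReal (exp ((s / 2 - a - (s / 2 + a)) * (2 * x / 2)) *
          (2 * cosh (2 * x / 2)) ^ (-(s / 2 - a + (s / 2 + a)))) := by
    rw [← ENNReal.ofReal_mul (by positivity), ← ENNReal.ofReal_mul (by positivity)]
    congr 1
    rw [Real.cosh_add_cosh, show 2 * x / 2 = x by ring, one_mul, sub_self, zero_mul, exp_zero,
      one_mul, add_halves, show s / 2 - a + (s / 2 + a) = s by ring,
      show (s / 2 - a - (s / 2 + a)) * x = -a * (x + w / 2 + (x - w / 2)) by ring,
      rpow_neg (by positivity), rpow_neg (by positivity), one_div, inv_rpow (by positivity),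
      mul_rpow (by positivity) (by positivity), mul_rpow (by positivity) (by positivity),
      mul_rpow (by positivity) (by positivity)]
    field_simp
  calc ∫⁻ t in Ioi (0 : ℝ), schlaefliLIntegral a t ^ 2 * ENNReal.ofReal (t ^ (s - 1))
      = ∫⁻ t in Ioi (0 : ℝ), ∫⁻ v : ℝ, ∫⁻ u : ℝ, ENNReal.ofReal (exp (-a * (u + v))) *
          ENNReal.ofReal (t ^ (s - 1) * exp (-((cosh u + cosh v) * t))) :=
        setLIntegral_congr_fun measurableSet_Ioi hexpand
    _ = ∫⁻ v : ℝ, ∫⁻ u : ℝ, ∫⁻ t in Ioi (0 : ℝ), ENNReal.ofReal (exp (-a * (u + v))) *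
          ENNReal.ofReal (t ^ (s - 1) * exp (-((cosh u + cosh v) * t))) := by
        rw [lintegral_lintegral_swap
          (Measurable.lintegral_prod_right (by fun_prop)).aemeasurable]
        refine lintegral_congr fun v => ?_
        exact lintegral_lintegral_swap (by fun_prop)
    _ = ∫⁻ w : ℝ, ∫⁻ x : ℝ, ENNReal.ofReal (exp (-a * (x + w / 2 + (x - w / 2))) *
          ((1 / (cosh (x + w / 2) + cosh (x - w / 2))) ^ s * Real.Gamma s)) := by
        simp_rw [hinner]
        exact Real.lintegral_lintegral_eq_shear (F := fun u v => ENNReal.ofReal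
          (exp (-a * (u + v)) * ((1 / (cosh u + cosh v)) ^ s * Real.Gamma s))) (by fun_prop)
    _ = _ := by
        simp_rw [hsplit]
        have hinner_const (w : ℝ) := lintegral_const_mul (μ := volume)
          (ENNReal.ofReal (2 ^ s * Real.Gamma s) * ENNReal.ofReal
            (exp ((s / 2 - s / 2) * (1 * w / 2)) *
              (2 * cosh (1 * w / 2)) ^ (-(s / 2 + s / 2))))
          (f := fun x : ℝ => ENNReal.ofReal
            (exp ((s / 2 - a - (s / 2 + a)) * (2 * x / 2)) *
              (2 * cosh (2 * x / 2)) ^ (-(s / 2 - a + (s / 2 + a))))) (by fun_prop)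
        simp_rw [hinner_const, Real.lintegral_exp_mul_cosh_rpow h₁ h₂ two_pos]
        rw [lintegral_mul_const _ (by fun_prop), lintegral_const_mul _ (by fun_prop),
          Real.lintegral_exp_mul_cosh_rpow (half_pos hs) (half_pos hs) one_pos,
          ← ENNReal.ofReal_mul (by positivity), ← ENNReal.ofReal_mul (by positivity)]

theorem matK_square_integral (l α : ℝ) (hl : -1 < l) (hα : 0 < 2 * α + l + 1) :
    (∫ t in Ioi (0 : ℝ), (matK α t * t ^ α) ^ 2 * t ^ (2 * l + 1)) =
      Real.sqrt Real.pi * Real.Gamma (α + l + 1) * Real.Gamma (2 * α + l + 1) *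
        Real.Gamma (l + 1) / (4 * Real.Gamma (α + l + 3 / 2)) := by
  set s : ℝ := 2 * (α + l + 1) with hs_def
  have hs : 0 < α + l + 1 := by linarith
  have h₁ : s / 2 - α = l + 1 := by rw [hs_def]; ring
  have h₂ : s / 2 + α = 2 * α + l + 1 := by rw [hs_def]; ring
  have h₃ : s / 2 = α + l + 1 := by rw [hs_def]; ring
  have hβ₁ := ProbabilityTheory.beta_pos hs hs
  have hβ₂ := ProbabilityTheory.beta_pos (show 0 < l + 1 by linarith) hα
  have hGs := Real.Gamma_pos_of_pos (show 0 < s by linarith)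
  have hmellin := lintegral_schlaefliLIntegral_sq_mul_rpow (a := α) (s := s)
    (by linarith) (by linarith)
  have hmeas : Measurable fun t : ℝ =>
      schlaefliLIntegral α t ^ 2 * ENNReal.ofReal (t ^ (s - 1)) :=
    ((measurable_schlaefliLIntegral α).pow_const 2).mul (by fun_prop)
  have hcongr (t : ℝ) (ht : t ∈ Ioi (0 : ℝ)) :
      (matK α t * t ^ α) ^ 2 * t ^ (2 * l + 1) =
      1 / 4 * (schlaefliLIntegral α t ^ 2 * ENNReal.ofReal (t ^ (s - 1))).toReal := by
    have ht' : 0 < t := ht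
    rw [matK_eq_toReal_schlaefliLIntegral, ENNReal.toReal_mul, ENNReal.toReal_pow,
      ENNReal.toReal_ofReal (by positivity),
      show s - 1 = α + α + (2 * l + 1) by rw [hs_def]; ring, rpow_add ht' (α + α),
      rpow_add ht' α α]
    ring
  rw [setIntegral_congr_fun measurableSet_Ioi hcongr, integral_const_mul,
    integral_toReal hmeas.aemeasurable
      (ae_lt_top hmeas (by rw [hmellin]; exact ENNReal.ofReal_ne_top)),
    hmellin, h₁, h₂, h₃, ENNReal.toReal_ofReal (by positivity), ProbabilityTheory.beta,
    ProbabilityTheory.beta, show α + l + 1 + (α + l + 1) = s by rw [hs_def]; ring,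
    show l + 1 + (2 * α + l + 1) = s by rw [hs_def]; ring]
  have hdup := Real.Gamma_mul_Gamma_add_half (α + l + 1)
  rw [← hs_def, show α + l + 1 + 1 / 2 = α + l + 3 / 2 by ring, rpow_sub two_pos,
    rpow_one] at hdup
  have hGh := Real.Gamma_pos_of_pos (show 0 < α + l + 3 / 2 by linarith)
  have h2s : (0 : ℝ) < 2 ^ s := by positivity
  generalize Real.Gamma (α + l + 3 / 2) = h at *
  generalize Real.Gamma (2 * α + l + 1) = k at *
  generalize Real.Gamma s = g at *
  generalize (2 : ℝ) ^ s = e at *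
  field_simp at hdup ⊢
  linear_combination Real.Gamma (l + 1) * k * hdup
end
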